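/- arXiv:1605.06912 — 2 statements merged into one kernel-verified Lean document; each statement's English description precedes it below -/
import Mathlib

section
/- (Order 2−α approximation with weights of power −1−α.) Let 0 < α < 1, x > 0, and let y be smooth (C^∞) on [0, x]. Define S_n[β] = Σ_{k=1}^{n−1} k^{−β} − ζ(β) and the weights σ₀ = ζ(α) − ζ(1+α), σ₁ = 1 − ζ(α), σ_k = k^{−1−α} for 2 ≤ k ≤ n−2, σ_{n−1} = (n−1)^{−1−α} − n S_n[α+1] + S_n[α] − n^{1−α}/(α(1−α)), σ_n = (n−1) S_n[α+1] − S_n[α] + n^{1−α}/(α(1−α)). Then there exists C > 0 (independent of n) such that for all integers n ≥ 4, with h = x/n, | (1/(Γ(−α)h^α)) Σ_{k=0}^{n} σ_k y(x−kh) − D^α y(x) | ≤ C h^{2−α}. -/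
/-- Real values of the Riemann zeta function at real arguments
(real part of the analytic continuation). -/
noncomputable def zr (s : ℝ) : ℝ := (riemannZeta s).re

/-- The Caputo derivative of order `α` of `y` at `x`. -/
noncomputable def caputo (α : ℝ) (y : ℝ → ℝ) (x : ℝ) : ℝ :=
  (1 / Real.Gamma (1 - α)) * ∫ t in (0:ℝ)..x, deriv y t / (x - t) ^ α

/-- `S_n[β] = Σ_{k=1}^{n−1} k^{−β} − ζ(β)`. -/
noncomputable def S (n : ℕ) (β : ℝ) : ℝ :=
  (∑ k ∈ Finset.Icc 1 (n - 1), (k:ℝ) ^ (-β)) - zr β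

open Filter Topology MeasureTheory

/-- The defect in approximating `(1 - s) m⁻ˢ` by the increment of `t ↦ t ^ (1 - s)` at
`m = k + 1`. -/
noncomputable def zetaDefect (k : ℕ) (s : ℂ) : ℂ :=
  (1 - s) * ((k + 1 : ℝ) : ℂ) ^ (-s)
    - (((k + 2 : ℝ) : ℂ) ^ (1 - s) - ((k + 1 : ℝ) : ℂ) ^ (1 - s))

lemma hasDerivAt_ofReal_cpow_of_pos (s : ℂ) {t : ℝ} (ht : 0 < t) :
    HasDerivAt (fun t : ℝ => (t : ℂ) ^ s) (s * (t : ℂ) ^ (s - 1)) t := by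
  have h := ((hasDerivAt_id (t : ℂ)).cpow_const (c := s) (Or.inl (by simpa using ht))).comp_ofReal
  simpa using h

lemma norm_zetaDefect_le (k : ℕ) {s : ℂ} (hs : 0 < s.re) :
    ‖zetaDefect k s‖ ≤ ‖1 - s‖ * (‖s‖ * (k + 1 : ℝ) ^ (-s.re - 1)) := by
  have hm : (0 : ℝ) < k + 1 := by positivity
  set m : ℝ := k + 1 with hmdef
  have h1 : ∀ t ∈ Set.Icc m (m + 1),
      ‖(t : ℂ) ^ (-s) - (m : ℂ) ^ (-s)‖ ≤ ‖s‖ * m ^ (-s.re - 1) * (t - m) := by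
    refine norm_image_sub_le_of_norm_deriv_le_segment'
      (f' := fun t : ℝ => -s * (t : ℂ) ^ (-s - 1))
      (fun t ht => (hasDerivAt_ofReal_cpow_of_pos (-s) (hm.trans_le ht.1)).hasDerivWithinAt) ?_
    intro t ht
    have ht0 : 0 < t := hm.trans_le ht.1
    rw [norm_mul, norm_neg, Complex.norm_cpow_eq_rpow_re_of_pos ht0]
    gcongr
    simpa using Real.rpow_le_rpow_of_nonpos hm ht.1 (by linarith : -s.re - 1 ≤ 0)
  have h2 := norm_image_sub_le_of_norm_deriv_le_segment' (a := m) (b := m + 1)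
      (f := fun t : ℝ => (t : ℂ) * ((1 - s) * (m : ℂ) ^ (-s)) - (t : ℂ) ^ (1 - s))
      (f' := fun t : ℝ => (1 - s) * (m : ℂ) ^ (-s) - (1 - s) * (t : ℂ) ^ (1 - s - 1))
      (C := ‖1 - s‖ * (‖s‖ * m ^ (-s.re - 1)))
      (fun t ht => by
        have e : HasDerivAt (fun t : ℝ => (t : ℂ) * ((1 - s) * (m : ℂ) ^ (-s)))
            (1 * ((1 - s) * (m : ℂ) ^ (-s))) t :=
          (Complex.ofRealCLM.hasDerivAt (x := t)).mul_const _
        rw [one_mul] at e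
        exact (e.sub (hasDerivAt_ofReal_cpow_of_pos (1 - s) (hm.trans_le ht.1))).hasDerivWithinAt)
      (fun t ht => by
        rw [← mul_sub, norm_mul, show 1 - s - 1 = -s by ring]
        gcongr
        rw [norm_sub_rev]
        refine (h1 t ⟨ht.1, ht.2.le⟩).trans ?_
        refine mul_le_of_le_one_right (by positivity) (by linarith [ht.2]))
      (m + 1) (Set.right_mem_Icc.2 (by linarith))
  have e : zetaDefect k s = ((m + 1 : ℝ) : ℂ) * ((1 - s) * (m : ℂ) ^ (-s))
      - ((m + 1 : ℝ) : ℂ) ^ (1 - s) - ((m : ℂ) * ((1 - s) * (m : ℂ) ^ (-s))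
      - (m : ℂ) ^ (1 - s)) := by
    rw [zetaDefect, show (k + 2 : ℝ) = m + 1 by rw [hmdef]; ring, ← hmdef]
    push_cast
    ring
  rw [e]
  simpa using h2

lemma differentiable_zetaDefect (k : ℕ) : Differentiable ℂ (zetaDefect k) := by
  have h1 : ((k + 1 : ℝ) : ℂ) ≠ 0 := by exact_mod_cast (by positivity : (k + 1 : ℝ) ≠ 0)
  have h2 : ((k + 2 : ℝ) : ℂ) ≠ 0 := by exact_mod_cast (by positivity : (k + 2 : ℝ) ≠ 0)
  unfold zetaDefect
  refine ((differentiable_const _).sub differentiable_id).mul ?_ |>.sub (.sub ?_ ?_)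
  · exact (differentiable_neg).const_cpow (Or.inl h1)
  · exact ((differentiable_const _).sub differentiable_id).const_cpow (Or.inl h2)
  · exact ((differentiable_const _).sub differentiable_id).const_cpow (Or.inl h1)

lemma sum_range_zetaDefect (n : ℕ) (s : ℂ) :
    ∑ k ∈ Finset.range n, zetaDefect k s
      = (1 - s) * ∑ k ∈ Finset.range n, ((k + 1 : ℝ) : ℂ) ^ (-s)
        - ((n + 1 : ℝ) : ℂ) ^ (1 - s) + 1 := by
  induction n with
  | zero => simp
  | succ n ih =>
    rw [Finset.sum_range_succ, Finset.sum_range_succ, ih, zetaDefect,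
      show ((n + 1 : ℕ) : ℝ) + 1 = n + 2 by push_cast; ring]
    ring

lemma summable_succ_rpow {p : ℝ} (hp : p < -1) : Summable fun k : ℕ => (k + 1 : ℝ) ^ p := by
  have h := (summable_nat_add_iff 1).2 (Real.summable_nat_rpow.2 hp)
  simpa using h

lemma summable_zetaDefect {s : ℂ} (hs : 0 < s.re) : Summable fun k => zetaDefect k s :=
  .of_norm_bounded (((summable_succ_rpow (by linarith : -s.re - 1 < -1)).mul_left _).mul_left _)
    fun k => norm_zetaDefect_le k hs

lemma hasSum_succ_cpow {s : ℂ} (hs : 1 < s.re) :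
    HasSum (fun k : ℕ => ((k + 1 : ℝ) : ℂ) ^ (-s)) (riemannZeta s) := by
  have hsum : Summable fun k : ℕ => ((k + 1 : ℝ) : ℂ) ^ (-s) := by
    refine .of_norm_bounded (summable_succ_rpow (by linarith : -s.re < -1)) fun k => ?_
    rw [Complex.norm_cpow_eq_rpow_re_of_pos (by positivity)]
    simp
  have h := zeta_eq_tsum_one_div_nat_add_one_cpow hs
  rw [h]
  convert! hsum.hasSum using 3 with k
  push_cast
  rw [Complex.cpow_neg, one_div]

lemma tendsto_succ_cpow_of_re_neg {s : ℂ} (hs : s.re < 0) :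
    Tendsto (fun n : ℕ => ((n + 1 : ℝ) : ℂ) ^ s) atTop (𝓝 0) := by
  rw [tendsto_zero_iff_norm_tendsto_zero]
  have h : Tendsto (fun n : ℕ => ((n : ℝ) + 1) ^ (- (-s.re))) atTop (𝓝 0) :=
    (tendsto_rpow_neg_atTop (by linarith)).comp
      (tendsto_atTop_add_const_right _ _ tendsto_natCast_atTop_atTop)
  refine h.congr fun n => ?_
  rw [Complex.norm_cpow_eq_rpow_re_of_pos (by positivity), neg_neg]

lemma tsum_zetaDefect_of_one_lt_re {s : ℂ} (hs : 1 < s.re) :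
    ∑' k, zetaDefect k s = 1 - riemannZeta₁ s := by
  have h1 := (summable_zetaDefect (by linarith : 0 < s.re)).hasSum.tendsto_sum_nat
  have h2 : Tendsto (fun n => ∑ k ∈ Finset.range n, zetaDefect k s) atTop
      (𝓝 ((1 - s) * riemannZeta s - 0 + 1)) := by
    simp_rw [sum_range_zetaDefect]
    exact (((hasSum_succ_cpow hs).tendsto_sum_nat.const_mul _).sub
      (tendsto_succ_cpow_of_re_neg (by simpa using hs))).add_const 1
  have hs1 : s ≠ 1 := fun h => by simp [h] at hs
  rw [tendsto_nhds_unique h1 h2, riemannZeta_eq_inv_sub_mul hs1]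
  have : s - 1 ≠ 0 := sub_ne_zero.2 hs1
  field_simp
  ring

/-- The series of defects continues `1 - (s - 1) ζ(s)` to the half-plane `0 < Re s`. -/
lemma tsum_zetaDefect {s : ℂ} (hs : 0 < s.re) : ∑' k, zetaDefect k s = 1 - riemannZeta₁ s := by
  obtain ⟨a, ha0, ha⟩ := exists_between (lt_min hs one_pos)
  set R := ‖s‖ + 3
  set U : Set ℂ := {z | a < z.re} ∩ Metric.ball 0 R
  have hU : IsOpen U := (isOpen_lt continuous_const Complex.continuous_re).inter Metric.isOpen_ball
  have hUc : Convex ℝ U := (convex_halfSpace_re_gt a).inter (convex_ball 0 R)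
  have hsU : s ∈ U := ⟨ha.trans_le (min_le_left _ _), by simp [R]⟩
  have h2U : (2 : ℂ) ∈ U := ⟨by
    have := ha.trans_le (min_le_right _ _)
    simp only [Set.mem_ofPred_eq, Complex.re_ofNat]; linarith, by
    simp [R]; linarith [norm_nonneg s]⟩
  have hd : DifferentiableOn ℂ (fun z => ∑' k, zetaDefect k z) U := by
    refine Complex.differentiableOn_tsum_of_summable_norm
      (u := fun k : ℕ => (1 + R) * (R * (k + 1 : ℝ) ^ (-a - 1)))
      (((summable_succ_rpow (by linarith : -a - 1 < -1)).mul_left _).mul_left _)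
      (fun k => (differentiable_zetaDefect k).differentiableOn) hU fun k z hz => ?_
    have hzR : ‖z‖ ≤ R := (mem_ball_zero_iff.1 hz.2).le
    have hza : a < z.re := hz.1
    refine (norm_zetaDefect_le k (ha0.trans hza)).trans ?_
    have : ‖1 - z‖ ≤ 1 + R := (norm_sub_le _ _).trans (by simpa using hzR)
    have hR : 0 ≤ R := by positivity
    gcongr
    simp
  refine (hd.analyticOnNhd hU).eqOn_of_preconnected_of_eventuallyEq
    ((differentiable_const (1 : ℂ)).sub differentiable_riemannZeta₁
      |>.differentiableOn.analyticOnNhd hU) hUc.isPreconnected h2U ?_ hsU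
  filter_upwards [(isOpen_lt continuous_const Complex.continuous_re).mem_nhds
    (show (1 : ℝ) < (2 : ℂ).re by simp)] with z hz
  exact tsum_zetaDefect_of_one_lt_re hz

lemma tendsto_sum_rpow_neg_sub {a : ℝ} (ha0 : 0 < a) (ha1 : a ≠ 1) :
    Tendsto (fun n : ℕ => ∑ k ∈ Finset.range n, (k + 1 : ℝ) ^ (-a)
      - (n + 1 : ℝ) ^ (1 - a) / (1 - a)) atTop (𝓝 (zr a)) := by
  have hs : 0 < (a : ℂ).re := by simpa using ha0
  have hs1 : (a : ℂ) ≠ 1 := by exact_mod_cast ha1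
  have h0 : (1 - a) ≠ 0 := sub_ne_zero.2 (Ne.symm ha1)
  have h1 := (summable_zetaDefect hs).hasSum.tendsto_sum_nat
  rw [tsum_zetaDefect hs] at h1
  have h2 := (Complex.continuous_re.tendsto _).comp h1
  have e : (1 - riemannZeta₁ a).re = 1 + (1 - a) * zr a := by
    have h3 : (a : ℂ) - 1 ≠ 0 := sub_ne_zero.2 hs1
    have : riemannZeta₁ a = ((a - 1 : ℝ) : ℂ) * riemannZeta a := by
      rw [riemannZeta_eq_inv_sub_mul hs1]
      push_cast
      field_simp
    rw [this, Complex.sub_re, Complex.re_ofReal_mul, zr, Complex.one_re]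
    ring
  rw [e] at h2
  have h4 := (h2.sub_const 1).div_const (1 - a)
  rw [show (1 + (1 - a) * zr a - 1) / (1 - a) = zr a by field_simp; ring] at h4
  refine h4.congr fun n => ?_
  have e2 : (∑ k ∈ Finset.range n, zetaDefect k (a : ℂ))
      = (((1 - a) * ∑ k ∈ Finset.range n, (k + 1 : ℝ) ^ (-a) - (n + 1 : ℝ) ^ (1 - a) + 1 : ℝ) : ℂ)
      := by
    rw [sum_range_zetaDefect]
    simp only [Complex.ofReal_add, Complex.ofReal_sub, Complex.ofReal_mul, Complex.ofReal_one,
      Complex.ofReal_sum]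
    congr 2
    · congr 1
      refine Finset.sum_congr rfl fun k _ => ?_
      rw [Complex.ofReal_cpow (by positivity)]
      push_cast; rfl
    · rw [Complex.ofReal_cpow (by positivity)]
      push_cast; rfl
  simp only [Function.comp, e2, Complex.ofReal_re]
  field_simp
  ring

lemma S_succ (m : ℕ) (a : ℝ) :
    S (m + 1) a = ∑ k ∈ Finset.range m, (k + 1 : ℝ) ^ (-a) - zr a := by
  rw [S, Nat.add_sub_cancel, Finset.range_eq_Ico, Finset.sum_Ico_eq_sum_range,
    ← Finset.Ico_add_one_right_eq_Icc, Finset.sum_Ico_eq_sum_range]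
  simp [add_comm]

lemma S_add_two (m : ℕ) (a : ℝ) : S (m + 2) a = S (m + 1) a + (m + 1 : ℝ) ^ (-a) := by
  rw [S_succ (m + 1), S_succ, Finset.sum_range_succ]
  ring

lemma tendsto_S_sub {a : ℝ} (ha0 : 0 < a) (ha1 : a ≠ 1) :
    Tendsto (fun m : ℕ => S (m + 1) a - (m + 1 : ℝ) ^ (1 - a) / (1 - a)) atTop (𝓝 0) := by
  have h := (tendsto_sum_rpow_neg_sub ha0 ha1).sub_const (zr a)
  rw [sub_self] at h
  refine h.congr fun m => ?_
  rw [S_succ]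
  ring

lemma tendsto_succ_rpow_neg {a : ℝ} (ha : 0 < a) :
    Tendsto (fun m : ℕ => (m + 1 : ℝ) ^ (-a)) atTop (𝓝 0) :=
  (tendsto_rpow_neg_atTop ha).comp
    (tendsto_atTop_add_const_right _ _ tendsto_natCast_atTop_atTop)

lemma rpow_neg_sub_rpow_neg_bounds {a t : ℝ} (ha : 0 < a) (ht : 0 < t) :
    (t + 1) ^ (-(a + 1)) ≤ (t ^ (-a) - (t + 1) ^ (-a)) / a ∧
      (t ^ (-a) - (t + 1) ^ (-a)) / a ≤ t ^ (-(a + 1)) := by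
  obtain ⟨u, hu, he⟩ := exists_hasDerivAt_eq_slope (fun s : ℝ => s ^ (-a))
    (fun s => -a * s ^ (-a - 1)) (lt_add_one t)
    (fun s hs => (Real.continuousAt_rpow_const _ _
      (Or.inl (ht.trans_le hs.1).ne')).continuousWithinAt)
    (fun s hs => Real.hasDerivAt_rpow_const (Or.inl (ht.trans hs.1).ne'))
  have e : (t ^ (-a) - (t + 1) ^ (-a)) / a = u ^ (-(a + 1)) := by
    rw [add_sub_cancel_left, div_one, show -a - 1 = -(a + 1) by ring] at he
    field_simp
    linarith
  rw [e]
  exact ⟨Real.rpow_le_rpow_of_nonpos (ht.trans hu.1) hu.2.le (by linarith),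
    Real.rpow_le_rpow_of_nonpos ht hu.1.le (by linarith)⟩

lemma rpow_le_tangent {a s t : ℝ} (ha0 : 0 < a) (ha1 : a < 1) (hs : 0 < s) (ht : 0 ≤ t) :
    t ^ (1 - a) ≤ s ^ (1 - a) + (1 - a) * s ^ (-a) * (t - s) := by
  have h := rpow_one_add_le_one_add_mul_self (s := t / s - 1) (p := 1 - a)
    (by linarith [div_nonneg ht hs.le]) (by linarith) (by linarith)
  rw [add_sub_cancel, Real.div_rpow ht hs.le, div_le_iff₀ (by positivity)] at h
  refine h.trans_eq ?_
  have : s ^ (1 - a) = s * s ^ (-a) := by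
    rw [sub_eq_add_neg, Real.rpow_add hs, Real.rpow_one]
  rw [this]
  field_simp

/-- A convex sequence tending to zero is nonnegative. -/
lemma nonneg_of_convex_of_tendsto_zero {e : ℕ → ℝ}
    (hconv : ∀ n, 0 ≤ e (n + 2) - 2 * e (n + 1) + e n)
    (h : Tendsto e atTop (𝓝 0)) (n : ℕ) : 0 ≤ e n := by
  have hmono : Monotone fun n => e (n + 1) - e n :=
    monotone_nat_of_le_succ fun n => by linarith [hconv n]
  have hlim : Tendsto (fun n => e (n + 1) - e n) atTop (𝓝 0) := by
    simpa using ((tendsto_add_atTop_iff_nat 1).2 h).sub h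
  have hanti : Antitone e :=
    antitone_nat_of_succ_le fun n => by linarith [hmono.ge_of_tendsto hlim n]
  exact hanti.le_of_tendsto h n

/-- Bounds for the tail of `∑ k ^ (-(a + 1))` by integrals. -/
lemma S_add_rpow_bounds {a : ℝ} (ha : 0 < a) (m : ℕ) :
    0 ≤ S (m + 2) (a + 1) + (m + 1 : ℝ) ^ (-a) / a ∧
      S (m + 2) (a + 1) + (m + 1 : ℝ) ^ (-a) / a ≤ (m + 1 : ℝ) ^ (-(a + 1)) := by
  have hstep : ∀ m : ℕ, S (m + 3) (a + 1) = S (m + 2) (a + 1) + (m + 1 + 1 : ℝ) ^ (-(a + 1)) :=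
    fun m => by simpa using S_add_two (m + 1) (a + 1)
  have hb := fun m : ℕ => rpow_neg_sub_rpow_neg_bounds ha (show (0 : ℝ) < m + 1 by positivity)
  have h0 := tendsto_succ_rpow_neg ha
  have hS : Tendsto (fun m : ℕ => S (m + 2) (a + 1)) atTop (𝓝 0) := by
    have h := tendsto_S_sub (a := a + 1) (by linarith) (by linarith)
    have h1 : Tendsto (fun m : ℕ => S (m + 1) (a + 1)) atTop (𝓝 0) := by
      have h2 := h.add (h0.div_const (-a))
      simp only [zero_div, add_zero] at h2
      refine h2.congr fun m => ?_
      rw [show 1 - (a + 1) = -a by ring]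
      ring
    exact (tendsto_add_atTop_iff_nat 1).2 h1
  have hlo : Antitone fun m : ℕ => S (m + 2) (a + 1) + (m + 1 : ℝ) ^ (-a) / a := by
    refine antitone_nat_of_succ_le fun m => ?_
    have := (hb m).1
    rw [sub_div] at this
    push_cast
    linarith [hstep m]
  have hhi : Monotone fun m : ℕ => S (m + 2) (a + 1) + (m + 1 + 1 : ℝ) ^ (-a) / a := by
    refine monotone_nat_of_le_succ fun m => ?_
    have := (hb (m + 1)).2
    rw [sub_div] at this
    push_cast at this ⊢
    linarith [hstep m]
  have h1 := hlo.le_of_tendsto (by simpa using hS.add (h0.div_const a)) m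
  have h2 := hhi.ge_of_tendsto (by
    simpa using hS.add (((tendsto_add_atTop_iff_nat 1).2 h0).div_const a)) m
  refine ⟨h1, ?_⟩
  have := (hb m).2
  rw [sub_div] at this
  linarith

lemma nonpos_of_second_deriv_nonpos {F F' F'' : ℝ → ℝ}
    (h : ∀ u ∈ Set.Icc (0 : ℝ) 1, HasDerivAt F (F' u) u)
    (h' : ∀ u ∈ Set.Icc (0 : ℝ) 1, HasDerivAt F' (F'' u) u)
    (hF : F 0 = 0) (hF' : F' 0 = 0) (hneg : ∀ u ∈ Set.Icc (0 : ℝ) 1, F'' u ≤ 0) : F 1 ≤ 0 := by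
  have h1 : AntitoneOn F' (Set.Icc 0 1) :=
    antitoneOn_of_hasDerivWithinAt_nonpos (convex_Icc 0 1)
      (fun u hu => (h' u hu).continuousAt.continuousWithinAt)
      (fun u hu => (h' u (interior_subset hu)).hasDerivWithinAt)
      (fun u hu => hneg u (interior_subset hu))
  have h2 : AntitoneOn F (Set.Icc 0 1) :=
    antitoneOn_of_hasDerivWithinAt_nonpos (convex_Icc 0 1)
      (fun u hu => (h u hu).continuousAt.continuousWithinAt)
      (fun u hu => (h u (interior_subset hu)).hasDerivWithinAt)
      (fun u hu => (h1 (by simp) (interior_subset hu) (interior_subset hu).1).trans_eq hF')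
  exact (h2 (by simp) (by simp) zero_le_one).trans_eq hF

lemma convexOn_Ioi_rpow_of_nonpos {p : ℝ} (hp : p ≤ 0) :
    ConvexOn ℝ (Set.Ioi 0) fun s : ℝ => s ^ p := by
  refine convexOn_of_hasDerivWithinAt2_nonneg (convex_Ioi 0)
    (f' := fun s => p * s ^ (p - 1)) (f'' := fun s => p * ((p - 1) * s ^ (p - 1 - 1)))
    (fun s hs => (Real.continuousAt_rpow_const _ _ (Or.inl (ne_of_gt hs))).continuousWithinAt)
    ?_ ?_ ?_ <;> rw [interior_Ioi]
  · exact fun s hs => (Real.hasDerivAt_rpow_const (Or.inl (ne_of_gt hs))).hasDerivWithinAt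
  · exact fun s hs =>
      ((Real.hasDerivAt_rpow_const (Or.inl (ne_of_gt hs))).const_mul p).hasDerivWithinAt
  · intro s hs
    rw [← mul_assoc]
    exact mul_nonneg (mul_nonneg_of_nonpos_of_nonpos hp (by linarith))
      (Real.rpow_nonneg (le_of_lt hs) _)

/-- Second differences of `f t = t ^ (1 - a) / (a (1 - a))`, whose second derivative is
`-t ^ (-(a + 1))`. -/
lemma second_diff_rpow_bounds {a t : ℝ} (ha0 : 0 < a) (ha1 : a < 1) (ht : 1 < t) :
    ((t + 1) ^ (1 - a) - 2 * t ^ (1 - a) + (t - 1) ^ (1 - a)) / (a * (1 - a))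
        ≤ -t ^ (-(a + 1)) ∧
      -((t + 1) ^ (-(a + 1)) + (t - 1) ^ (-(a + 1))) / 2 ≤
        ((t + 1) ^ (1 - a) - 2 * t ^ (1 - a) + (t - 1) ^ (1 - a)) / (a * (1 - a)) := by
  have h1a : 0 < 1 - a := by linarith
  have hconv : ConvexOn ℝ (Set.Ioi 0) fun s : ℝ => s ^ (-(a + 1)) :=
    convexOn_Ioi_rpow_of_nonpos (by linarith)
  have hp : ∀ (p u : ℝ), u ∈ Set.Icc (0 : ℝ) 1 →
      HasDerivAt (fun u => (t + u) ^ p) (p * (t + u) ^ (p - 1)) u := fun p u hu => by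
    simpa using ((hasDerivAt_id u).const_add t).rpow_const (p := p)
      (Or.inl (by simp only [id]; linarith [hu.1]))
  have hm : ∀ (p u : ℝ), u ∈ Set.Icc (0 : ℝ) 1 →
      HasDerivAt (fun u => (t - u) ^ p) (-(p * (t - u) ^ (p - 1))) u := fun p u hu => by
    simpa using ((hasDerivAt_id u).const_sub t).rpow_const (p := p)
      (Or.inl (by simp only [id]; linarith [hu.2]))
  have hV : ∀ q u : ℝ, u ∈ Set.Icc (0 : ℝ) 1 → HasDerivAt
      (fun u => ((t + u) ^ (1 - a) - 2 * t ^ (1 - a) + (t - u) ^ (1 - a)) / (a * (1 - a))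
        + q / 2 * u ^ 2) (((t + u) ^ (-a) - (t - u) ^ (-a)) / a + q * u) u := fun q u hu => by
    have := ((((hp (1 - a) u hu).sub_const (2 * t ^ (1 - a))).add (hm (1 - a) u hu)).div_const
      (a * (1 - a))).add (((hasDerivAt_id u).pow 2).const_mul (q / 2))
    convert! this using 1
    rw [show 1 - a - 1 = -a by ring]
    simp only [id]
    field_simp
    ring
  have hV' : ∀ q u : ℝ, u ∈ Set.Icc (0 : ℝ) 1 → HasDerivAt
      (fun u => ((t + u) ^ (-a) - (t - u) ^ (-a)) / a + q * u)
      (-((t + u) ^ (-(a + 1)) + (t - u) ^ (-(a + 1))) + q) u := fun q u hu => by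
    have := (((hp (-a) u hu).sub (hm (-a) u hu)).div_const a).add
      ((hasDerivAt_id u).const_mul q)
    convert! this using 1
    rw [show -a - 1 = -(a + 1) by ring]
    field_simp
    ring
  constructor
  · have := nonpos_of_second_deriv_nonpos (hV (2 * t ^ (-(a + 1)))) (hV' (2 * t ^ (-(a + 1))))
      (by ring_nf) (by simp) (fun u hu => by
        have h := hconv.2 (show t + u ∈ Set.Ioi (0 : ℝ) from by
          simp only [Set.mem_Ioi]; linarith [hu.1])
          (show t - u ∈ Set.Ioi (0 : ℝ) from by simp only [Set.mem_Ioi]; linarith [hu.2])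
          (show (0 : ℝ) ≤ 1 / 2 by norm_num) (show (0 : ℝ) ≤ 1 / 2 by norm_num) (by norm_num)
        simp only [smul_eq_mul] at h
        rw [show 1 / 2 * (t + u) + 1 / 2 * (t - u) = t by ring] at h
        linarith)
    linarith
  · have := nonpos_of_second_deriv_nonpos
      (fun u hu => (hV ((t + 1) ^ (-(a + 1)) + (t - 1) ^ (-(a + 1))) u hu).neg)
      (fun u hu => (hV' ((t + 1) ^ (-(a + 1)) + (t - 1) ^ (-(a + 1))) u hu).neg)
      (by simp; left; ring) (by simp) (fun u hu => by
        have e1 : (1 + u) / 2 + (1 - u) / 2 = 1 := by ring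
        have m1 : t + 1 ∈ Set.Ioi (0 : ℝ) := by simp only [Set.mem_Ioi]; linarith
        have m2 : t - 1 ∈ Set.Ioi (0 : ℝ) := by simp only [Set.mem_Ioi]; linarith
        have p1 : 0 ≤ (1 + u) / 2 := by linarith [hu.1]
        have p2 : 0 ≤ (1 - u) / 2 := by linarith [hu.2]
        have h1 := hconv.2 m1 m2 p1 p2 e1
        have h2 := hconv.2 m2 m1 p1 p2 e1
        simp only [smul_eq_mul] at h1 h2
        rw [show (1 + u) / 2 * (t + 1) + (1 - u) / 2 * (t - 1) = t + u by ring] at h1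
        rw [show (1 + u) / 2 * (t - 1) + (1 - u) / 2 * (t + 1) = t - u by ring] at h2
        linarith)
    simp only [Pi.neg_apply] at this
    linarith

/-- The value at `m + 1` of the Peano kernel of the quadrature error. -/
noncomputable def knot (a : ℝ) (m : ℕ) : ℝ :=
  (m + 1) * S (m + 2) (a + 1) - S (m + 2) a + (m + 1 : ℝ) ^ (1 - a) / (a * (1 - a))

lemma rpow_one_sub_eq {t : ℝ} (ht : 0 < t) (a : ℝ) : t ^ (1 - a) = t * t ^ (-a) := by
  rw [sub_eq_add_neg, Real.rpow_add ht, Real.rpow_one]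

lemma rpow_neg_eq {t : ℝ} (ht : 0 < t) (a : ℝ) : t ^ (-a) = t * t ^ (-(a + 1)) := by
  rw [← rpow_one_sub_eq ht]
  congr 1
  ring

lemma knot_succ (a : ℝ) (m : ℕ) : knot a (m + 1) - knot a m = S (m + 2) (a + 1)
    + ((m + 2 : ℝ) ^ (1 - a) - (m + 1 : ℝ) ^ (1 - a)) / (a * (1 - a)) := by
  have e : ∀ b, S (m + 1 + 2) b = S (m + 2) b + (m + 2 : ℝ) ^ (-b) := fun b => by
    rw [S_add_two (m + 1) b]
    push_cast
    ring_nf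
  rw [knot, knot, e, e, rpow_neg_eq (by positivity) a]
  push_cast
  rw [show (m + 1 + 1 : ℝ) = m + 2 by ring]
  ring

lemma tendsto_knot {a : ℝ} (ha0 : 0 < a) (ha1 : a < 1) : Tendsto (knot a) atTop (𝓝 0) := by
  have h0 := tendsto_succ_rpow_neg ha0
  have h1a : 0 < 1 - a := by linarith
  have h1 : Tendsto (fun m : ℕ => (m + 1) * (S (m + 2) (a + 1) + (m + 1 : ℝ) ^ (-a) / a)) atTop
      (𝓝 0) := by
    refine squeeze_zero (fun m => mul_nonneg (by positivity) (S_add_rpow_bounds ha0 m).1)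
      (fun m => ?_) h0
    conv_rhs => rw [rpow_neg_eq (by positivity : (0 : ℝ) < m + 1) a]
    exact mul_le_mul_of_nonneg_left (S_add_rpow_bounds ha0 m).2 (by positivity)
  have h2 : Tendsto (fun m : ℕ => ((m + 1 + 1 : ℝ) ^ (1 - a) - (m + 1 : ℝ) ^ (1 - a)) / (1 - a))
      atTop (𝓝 0) := by
    refine squeeze_zero (fun m => div_nonneg (sub_nonneg.2 ?_) h1a.le) (fun m => ?_) h0
    · exact Real.rpow_le_rpow (by positivity) (by linarith) h1a.le
    · rw [div_le_iff₀ h1a]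
      have := rpow_le_tangent ha0 ha1 (by positivity : (0 : ℝ) < m + 1)
        (by positivity : (0 : ℝ) ≤ m + 1 + 1)
      linarith
  have h3 := (tendsto_add_atTop_iff_nat 1).2 (tendsto_S_sub ha0 ha1.ne)
  have h := (h1.sub h3).sub h2
  simp only [sub_zero] at h
  refine h.congr fun m => ?_
  have e := rpow_one_sub_eq (by positivity : (0 : ℝ) < m + 1) a
  have e2 : (m + 1 : ℝ) ^ (1 - a) / (a * (1 - a))
      = (m + 1) * (m + 1 : ℝ) ^ (-a) / a + (m + 1 : ℝ) ^ (1 - a) / (1 - a) := by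
    rw [← e]
    field_simp
    ring
  rw [knot, e2]
  push_cast
  ring

lemma knot_bounds {a : ℝ} (ha0 : 0 < a) (ha1 : a < 1) (m : ℕ) :
    -(m + 1 : ℝ) ^ (-(a + 1)) ≤ knot a m ∧ knot a m ≤ 0 := by
  have hd : ∀ m : ℕ, knot a (m + 2) - 2 * knot a (m + 1) + knot a m = (m + 2 : ℝ) ^ (-(a + 1)) +
      ((m + 2 + 1 : ℝ) ^ (1 - a) - 2 * (m + 2 : ℝ) ^ (1 - a) + (m + 2 - 1 : ℝ) ^ (1 - a))
        / (a * (1 - a)) := fun m => by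
    have e1 := knot_succ a (m + 1)
    have e2 := knot_succ a m
    have e3 := S_add_two (m + 1) (a + 1)
    push_cast at e1 e3
    rw [show (m + 1 + 2 : ℝ) = m + 2 + 1 by ring, show (m + 1 + 1 : ℝ) = m + 2 by ring] at e1
    rw [show (m + 1 + 1 : ℝ) = m + 2 by ring] at e3
    rw [show (m + 2 - 1 : ℝ) = m + 1 by ring]
    rw [show m + 1 + 2 = m + 3 by ring] at e1 e3
    rw [show m + 1 + 1 = m + 2 by ring] at e1 e3
    linear_combination e1 - e2 + e3
  have hb := fun m : ℕ => second_diff_rpow_bounds ha0 ha1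
    (show (1 : ℝ) < m + 2 by linarith [(Nat.cast_nonneg m : (0 : ℝ) ≤ m)])
  have hk := tendsto_knot ha0 ha1
  constructor
  · have hp := nonneg_of_convex_of_tendsto_zero
      (e := fun m => knot a m + (m + 1 : ℝ) ^ (-(a + 1)) / 2) (fun m => by
        have h := (hb m).2
        have := hd m
        push_cast
        rw [show (m + 2 - 1 : ℝ) = m + 1 by ring] at h this
        rw [show (m + 1 + 1 : ℝ) = m + 2 by ring]
        linarith) (by
        simpa using hk.add ((tendsto_succ_rpow_neg (by linarith : 0 < a + 1)).div_const 2)) m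
    have : 0 ≤ (m + 1 : ℝ) ^ (-(a + 1)) := by positivity
    linarith
  · have hp := nonneg_of_convex_of_tendsto_zero (e := fun m => -knot a m) (fun m => by
      have h := (hb m).1
      have := hd m
      linarith) (by simpa using hk.neg) m
    linarith

/-- The Peano kernel on `[m + 1, m + 2]`. -/
lemma abs_kernel_le {a : ℝ} (ha0 : 0 < a) (ha1 : a < 1) (m : ℕ) {t : ℝ}
    (ht : t ∈ Set.Icc (m + 1 : ℝ) (m + 2)) :
    |S (m + 2) (a + 1) * t - S (m + 2) a + t ^ (1 - a) / (a * (1 - a))|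
      ≤ (m + 1 : ℝ) ^ (-(a + 1)) := by
  have hm : (0 : ℝ) < m + 1 := by positivity
  have h1a : 0 < 1 - a := by linarith
  have hk := knot_bounds ha0 ha1 m
  have hk' := knot_bounds ha0 ha1 (m + 1)
  have hs := knot_succ a m
  have hS := S_add_rpow_bounds ha0 m
  rw [abs_le]
  constructor
  · have hc := (Real.concaveOn_rpow h1a.le (by linarith)).2 (show (m + 1 : ℝ) ∈ Set.Ici 0 from hm.le)
      (show (m + 2 : ℝ) ∈ Set.Ici 0 by simp only [Set.mem_Ici]; positivity)
      (show (0 : ℝ) ≤ m + 2 - t by linarith [ht.2]) (show (0 : ℝ) ≤ t - (m + 1) by linarith [ht.1])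
      (by ring)
    simp only [smul_eq_mul] at hc
    rw [show (m + 2 - t) * (m + 1) + (t - (m + 1)) * (m + 2) = t by ring] at hc
    have hc' := div_le_div_of_nonneg_right hc (by positivity : 0 ≤ a * (1 - a))
    have hmono : (m + 1 + 1 : ℝ) ^ (-(a + 1)) ≤ (m + 1 : ℝ) ^ (-(a + 1)) :=
      Real.rpow_le_rpow_of_nonpos hm (by linarith) (by linarith)
    have hlow : -(m + 1 : ℝ) ^ (-(a + 1)) ≤ knot a (m + 1) := by
      have := hk'.1
      push_cast at this
      linarith
    have hcomb : (m + 2 - t) * knot a m + (t - (m + 1)) * knot a (m + 1)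
        ≤ S (m + 2) (a + 1) * t - S (m + 2) a + t ^ (1 - a) / (a * (1 - a)) := by
      rw [add_div, mul_div_assoc, mul_div_assoc] at hc'
      rw [sub_div] at hs
      have e : knot a (m + 1) = knot a m + (S (m + 2) (a + 1)
        + ((m + 2 : ℝ) ^ (1 - a) / (a * (1 - a)) - (m + 1 : ℝ) ^ (1 - a) / (a * (1 - a)))) := by
        linarith
      rw [e, knot]
      linarith
    refine le_trans ?_ hcomb
    have i1 := mul_le_mul_of_nonneg_left hk.1 (show (0 : ℝ) ≤ m + 2 - t by linarith [ht.2])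
    have i2 := mul_le_mul_of_nonneg_left hlow (show (0 : ℝ) ≤ t - (m + 1) by linarith [ht.1])
    linarith
  · have htan := rpow_le_tangent ha0 ha1 hm (hm.le.trans ht.1)
    have htan' := div_le_div_of_nonneg_right htan (by positivity : 0 ≤ a * (1 - a))
    have e : ((m + 1 : ℝ) ^ (1 - a) + (1 - a) * (m + 1 : ℝ) ^ (-a) * (t - (m + 1))) / (a * (1 - a))
        = (m + 1 : ℝ) ^ (1 - a) / (a * (1 - a)) + (m + 1 : ℝ) ^ (-a) / a * (t - (m + 1)) := by
      field_simp
    rw [e] at htan'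
    have hup : S (m + 2) (a + 1) * t - S (m + 2) a + t ^ (1 - a) / (a * (1 - a))
        ≤ knot a m + (S (m + 2) (a + 1) + (m + 1 : ℝ) ^ (-a) / a) * (t - (m + 1)) := by
      rw [knot]
      linarith
    have i1 : (S (m + 2) (a + 1) + (m + 1 : ℝ) ^ (-a) / a) * (t - (m + 1))
        ≤ S (m + 2) (a + 1) + (m + 1 : ℝ) ^ (-a) / a :=
      mul_le_of_le_one_right hS.1 (by linarith [ht.2])
    linarith [hk.2, hS.2]

lemma intervalIntegrable_rpow_neg_mul {a : ℝ} (ha1 : a < 1) {f : ℝ → ℝ} (hf : Continuous f)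
    (u v : ℝ) : IntervalIntegrable (fun t => t ^ (-a) * f t) volume u v :=
  (intervalIntegral.intervalIntegrable_rpow' (by linarith)).mul_continuousOn hf.continuousOn

lemma integral_kernel_mul_deriv_deriv {a : ℝ} (ha0 : 0 < a) (ha1 : a < 1) {g g₁ g₂ : ℝ → ℝ}
    (hg : ∀ t, HasDerivAt g (g₁ t) t) (hg₁ : ∀ t, HasDerivAt g₁ (g₂ t) t) (hg₂ : Continuous g₂)
    {u v : ℝ} (hu : 0 ≤ u) (huv : u ≤ v) (p q : ℝ) :
    ∫ t in u..v, (p * t + q + t ^ (1 - a) / (a * (1 - a))) * g₂ t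
      = (p * v + q + v ^ (1 - a) / (a * (1 - a))) * g₁ v
        - (p * u + q + u ^ (1 - a) / (a * (1 - a))) * g₁ u
        - p * (g v - g u) - 1 / a * ∫ t in u..v, t ^ (-a) * g₁ t := by
  have h1a : 0 < 1 - a := by linarith
  have hc₁ : Continuous g₁ := continuous_iff_continuousAt.2 fun t => (hg₁ t).continuousAt
  have hint : IntervalIntegrable (fun t : ℝ => t ^ (-a)) volume u v :=
    intervalIntegral.intervalIntegrable_rpow' (by linarith)
  rw [intervalIntegral.integral_mul_deriv_eq_deriv_mul_of_hasDerivAt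
    (u := fun t => p * t + q + t ^ (1 - a) / (a * (1 - a))) (v := g₁)
    (u' := fun t => p + 1 / a * t ^ (-a)) (v' := g₂)]
  · have e : ∀ t, (p + 1 / a * t ^ (-a)) * g₁ t = p * g₁ t + 1 / a * (t ^ (-a) * g₁ t) :=
      fun t => by ring
    simp_rw [e]
    rw [intervalIntegral.integral_add ((hc₁.intervalIntegrable _ _).const_mul _)
      ((intervalIntegrable_rpow_neg_mul ha1 hc₁ _ _).const_mul _),
      intervalIntegral.integral_const_mul, intervalIntegral.integral_const_mul,
      intervalIntegral.integral_eq_sub_of_hasDerivAt (fun t _ => hg t)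
        (hc₁.intervalIntegrable _ _)]
    ring
  · have : Continuous fun t : ℝ => t ^ (1 - a) := Real.continuous_rpow_const h1a.le
    fun_prop
  · exact hc₁.continuousOn
  · intro t ht
    rw [min_eq_left huv] at ht
    have := (((hasDerivAt_id t).const_mul p).add_const q).add
      ((Real.hasDerivAt_rpow_const (p := 1 - a) (Or.inl (hu.trans_lt ht.1).ne')).div_const
        (a * (1 - a)))
    convert! this using 1
    rw [show 1 - a - 1 = -a by ring]
    field_simp
  · exact fun t _ => hg₁ t
  · exact (intervalIntegrable_const).add (hint.const_mul _)
  · exact hg₂.intervalIntegrable _ _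

/-- The last weight of the quadrature rule with `m + 2` cells. -/
noncomputable def lastWeight (a : ℝ) (m : ℕ) : ℝ :=
  (m + 1) * S (m + 2) (a + 1) - S (m + 2) a + (m + 2 : ℝ) ^ (1 - a) / (a * (1 - a))

lemma sum_integral_kernel {a : ℝ} (ha0 : 0 < a) (ha1 : a < 1) {g g₁ g₂ : ℝ → ℝ}
    (hg : ∀ t, HasDerivAt g (g₁ t) t) (hg₁ : ∀ t, HasDerivAt g₁ (g₂ t) t) (hg₂ : Continuous g₂)
    (m : ℕ) :
    ∑ k ∈ Finset.range m, ∫ t in (k + 1 : ℝ)..(k + 2 : ℝ),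
        (S (k + 2) (a + 1) * t - S (k + 2) a + t ^ (1 - a) / (a * (1 - a))) * g₂ t
      = knot a m * g₁ (m + 1) - knot a 0 * g₁ 1
        - (S (m + 2) (a + 1) * g (m + 1) - S 2 (a + 1) * g 1
          - ∑ k ∈ Finset.range m, (k + 2 : ℝ) ^ (-(a + 1)) * g (k + 2))
        - 1 / a * ∫ t in (1 : ℝ)..(m + 1 : ℝ), t ^ (-a) * g₁ t := by
  have hc₁ : Continuous g₁ := continuous_iff_continuousAt.2 fun t => (hg₁ t).continuousAt
  induction m with
  | zero => simp
  | succ m ih =>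
    have hcell := integral_kernel_mul_deriv_deriv ha0 ha1 hg hg₁ hg₂
      (by positivity : (0 : ℝ) ≤ m + 1) (by linarith : (m + 1 : ℝ) ≤ m + 2)
      (S (m + 2) (a + 1)) (-S (m + 2) a)
    simp only [← sub_eq_add_neg] at hcell
    have hadd := intervalIntegral.integral_add_adjacent_intervals
      (intervalIntegrable_rpow_neg_mul ha1 hc₁ 1 (m + 1 : ℝ))
      (intervalIntegrable_rpow_neg_mul ha1 hc₁ (m + 1 : ℝ) (m + 2 : ℝ))
    have hs := knot_succ a m
    have hS := S_add_two (m + 1) (a + 1)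
    have ek : S (m + 2) (a + 1) * (m + 2) - S (m + 2) a + (m + 2 : ℝ) ^ (1 - a) / (a * (1 - a))
        = knot a (m + 1) := by
      rw [sub_div] at hs
      rw [show knot a (m + 1) = knot a m + (S (m + 2) (a + 1)
        + ((m + 2 : ℝ) ^ (1 - a) / (a * (1 - a)) - (m + 1 : ℝ) ^ (1 - a) / (a * (1 - a)))) by
        linarith, knot]
      ring
    have ek' : S (m + 2) (a + 1) * (m + 1) - S (m + 2) a
        + (m + 1 : ℝ) ^ (1 - a) / (a * (1 - a)) = knot a m := by
      rw [knot]
      ring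
    rw [ek, ek'] at hcell
    push_cast at hS ⊢
    rw [show (m + 1 + 1 : ℝ) = m + 2 by ring] at hS ⊢
    rw [Finset.sum_range_succ, Finset.sum_range_succ, ih, hcell, ← hadd, hS]
    ring

lemma quadrature_error_eq {a : ℝ} (ha0 : 0 < a) (ha1 : a < 1) {g g₁ g₂ : ℝ → ℝ}
    (hg : ∀ t, HasDerivAt g (g₁ t) t) (hg₁ : ∀ t, HasDerivAt g₁ (g₂ t) t) (hg₂ : Continuous g₂)
    (m : ℕ) :
    (zr a - zr (a + 1)) * g 0 + (1 - zr a) * g 1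
        + ∑ k ∈ Finset.range m, (k + 2 : ℝ) ^ (-(a + 1)) * g (k + 2)
        - (S (m + 2) (a + 1) + lastWeight a m) * g (m + 1)
        + lastWeight a m * g (m + 2) - 1 / a * ∫ t in (0 : ℝ)..(m + 2 : ℝ), t ^ (-a) * g₁ t
      = (∫ t in (0 : ℝ)..1, ((zr a - zr (a + 1)) * t + 0 + t ^ (1 - a) / (a * (1 - a))) * g₂ t)
        + (∑ k ∈ Finset.range m, ∫ t in (k + 1 : ℝ)..(k + 2 : ℝ),
          (S (k + 2) (a + 1) * t - S (k + 2) a + t ^ (1 - a) / (a * (1 - a))) * g₂ t)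
        + ∫ t in (m + 1 : ℝ)..(m + 2 : ℝ), (-lastWeight a m * t + (lastWeight a m * (m + 2)
          - (m + 2 : ℝ) ^ (1 - a) / (a * (1 - a))) + t ^ (1 - a) / (a * (1 - a))) * g₂ t := by
  have hc₁ : Continuous g₁ := continuous_iff_continuousAt.2 fun t => (hg₁ t).continuousAt
  have hint := intervalIntegrable_rpow_neg_mul ha1 hc₁
  have hadd := intervalIntegral.integral_add_adjacent_intervals (hint 0 1) (hint 1 (m + 1 : ℝ))
  have hadd' := intervalIntegral.integral_add_adjacent_intervals (hint 0 (m + 1 : ℝ))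
    (hint (m + 1 : ℝ) (m + 2 : ℝ))
  have hS : ∀ b, S 2 b = 1 - zr b := fun b => by simp [S]
  have hk0 : knot a 0 = zr a - zr (a + 1) + 1 / (a * (1 - a)) := by
    simp [knot, hS]
  have hkm : knot a m = lastWeight a m + (m + 1 : ℝ) ^ (1 - a) / (a * (1 - a))
      - (m + 2 : ℝ) ^ (1 - a) / (a * (1 - a)) := by
    rw [knot, lastWeight]
    ring
  rw [sum_integral_kernel ha0 ha1 hg hg₁ hg₂,
    integral_kernel_mul_deriv_deriv ha0 ha1 hg hg₁ hg₂ le_rfl zero_le_one,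
    integral_kernel_mul_deriv_deriv ha0 ha1 hg hg₁ hg₂ (by positivity)
      (by linarith : (m + 1 : ℝ) ≤ m + 2), ← hadd', ← hadd, hk0, hkm, hS,
    Real.zero_rpow (by linarith), Real.one_rpow]
  ring

lemma abs_last_kernel_le {a : ℝ} (ha0 : 0 < a) (ha1 : a < 1) (m : ℕ) {t : ℝ}
    (ht : t ∈ Set.Icc (m + 1 : ℝ) (m + 2)) :
    |-lastWeight a m * t + (lastWeight a m * (m + 2)
        - (m + 2 : ℝ) ^ (1 - a) / (a * (1 - a))) + t ^ (1 - a) / (a * (1 - a))|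
      ≤ 1 + 1 / (a * (1 - a)) := by
  have hm : (0 : ℝ) < m + 1 := by positivity
  have h1a : 0 < 1 - a := by linarith
  have hc0 : 0 < a * (1 - a) := by positivity
  have hk := knot_bounds ha0 ha1 m
  have hp : (m + 1 : ℝ) ^ (-(a + 1)) ≤ 1 :=
    Real.rpow_le_one_of_one_le_of_nonpos (by linarith [(Nat.cast_nonneg m : (0 : ℝ) ≤ m)])
      (by linarith)
  have hkm : lastWeight a m = knot a m - (m + 1 : ℝ) ^ (1 - a) / (a * (1 - a))
      + (m + 2 : ℝ) ^ (1 - a) / (a * (1 - a)) := by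
    rw [knot, lastWeight]
    ring
  have hinc : (m + 2 : ℝ) ^ (1 - a) - (m + 1 : ℝ) ^ (1 - a) ≤ 1 := by
    have h := rpow_le_tangent ha0 ha1 hm (by positivity : (0 : ℝ) ≤ m + 2)
    have h2 : (m + 1 : ℝ) ^ (-a) ≤ 1 :=
      Real.rpow_le_one_of_one_le_of_nonpos (by linarith [(Nat.cast_nonneg m : (0 : ℝ) ≤ m)])
        (by linarith)
    have h3 : (1 - a) * (m + 1 : ℝ) ^ (-a) ≤ 1 := mul_le_one₀ (by linarith) (by positivity) h2
    linarith
  have m1 : (m + 1 : ℝ) ^ (1 - a) ≤ t ^ (1 - a) := Real.rpow_le_rpow hm.le ht.1 h1a.le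
  have m2 : t ^ (1 - a) ≤ (m + 2 : ℝ) ^ (1 - a) :=
    Real.rpow_le_rpow (hm.le.trans ht.1) ht.2 h1a.le
  have d1 := div_le_div_of_nonneg_right m1 hc0.le
  have d2 := div_le_div_of_nonneg_right m2 hc0.le
  have d3 := div_le_div_of_nonneg_right hinc hc0.le
  rw [sub_div] at d3
  have hr0 : 0 ≤ m + 2 - t := by linarith [ht.2]
  have hr1 : m + 2 - t ≤ 1 := by linarith [ht.1]
  have hc : 0 < 1 / (a * (1 - a)) := by positivity
  have w1 : -1 ≤ lastWeight a m := by linarith [hk.1]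
  have w2 : lastWeight a m ≤ 1 / (a * (1 - a)) := by linarith [hk.2]
  have i1 := mul_le_mul_of_nonneg_right w1 hr0
  have i2 := mul_le_mul_of_nonneg_right w2 hr0
  have i3 := mul_le_of_le_one_right hc.le hr1
  rw [abs_le]
  constructor <;> linarith

lemma abs_integral_mul_le {u v b c : ℝ} (huv : u + 1 = v) {f g : ℝ → ℝ} (hc : 0 ≤ c)
    (hf : ∀ t ∈ Set.Icc u v, |f t| ≤ c) (hg : ∀ t ∈ Set.Icc u v, |g t| ≤ b) :
    |∫ t in u..v, f t * g t| ≤ c * b := by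
  have h := intervalIntegral.norm_integral_le_of_norm_le_const (a := u) (b := v) (C := c * b)
    (f := fun t => f t * g t) (fun t ht => by
      rw [Set.uIoc_of_le (by linarith)] at ht
      have ht' : t ∈ Set.Icc u v := ⟨ht.1.le, ht.2⟩
      rw [Real.norm_eq_abs, abs_mul]
      exact mul_le_mul (hf t ht') (hg t ht') (abs_nonneg _) hc)
  rwa [show v - u = 1 by linarith, abs_one, mul_one] at h

lemma exists_quadrature_error_bound {a : ℝ} (ha0 : 0 < a) (ha1 : a < 1) :
    ∃ C > 0, ∀ (m : ℕ) (b : ℝ) (g g₁ g₂ : ℝ → ℝ), (∀ t, HasDerivAt g (g₁ t) t) →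
      (∀ t, HasDerivAt g₁ (g₂ t) t) → Continuous g₂ →
      (∀ t ∈ Set.Icc (0 : ℝ) (m + 2), |g₂ t| ≤ b) →
      |(zr a - zr (a + 1)) * g 0 + (1 - zr a) * g 1
        + ∑ k ∈ Finset.range m, (k + 2 : ℝ) ^ (-(a + 1)) * g (k + 2)
        - (S (m + 2) (a + 1) + lastWeight a m) * g (m + 1)
        + lastWeight a m * g (m + 2) - 1 / a * ∫ t in (0 : ℝ)..(m + 2 : ℝ), t ^ (-a) * g₁ t|
      ≤ C * b := by
  have h1a : 0 < 1 - a := by linarith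
  have hc0 : 0 < 1 / (a * (1 - a)) := by positivity
  have hsum := summable_succ_rpow (p := -(a + 1)) (by linarith)
  refine ⟨(|zr a - zr (a + 1)| + 1 / (a * (1 - a))) + (∑' k : ℕ, (k + 1 : ℝ) ^ (-(a + 1)))
    + (1 + 1 / (a * (1 - a))), ?_, fun m b g g₁ g₂ hg hg₁ hg₂ hb => ?_⟩
  · have : 0 ≤ ∑' k : ℕ, (k + 1 : ℝ) ^ (-(a + 1)) := tsum_nonneg fun k => by positivity
    positivity
  rw [quadrature_error_eq ha0 ha1 hg hg₁ hg₂, add_mul, add_mul]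
  have hb0 : 0 ≤ b := (abs_nonneg _).trans (hb 0 ⟨le_rfl, by positivity⟩)
  refine (abs_add_le _ _).trans (add_le_add ((abs_add_le _ _).trans (add_le_add ?_ ?_)) ?_)
  · refine abs_integral_mul_le (by norm_num) (by positivity) (fun t ht => ?_)
      (fun t ht => hb t ⟨ht.1, ht.2.trans (by linarith [(Nat.cast_nonneg m : (0 : ℝ) ≤ m)])⟩)
    have ht1 : |t| ≤ 1 := abs_le.2 ⟨by linarith [ht.1], ht.2⟩
    have hr0 : 0 ≤ t ^ (1 - a) := Real.rpow_nonneg ht.1 _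
    have hr1 : t ^ (1 - a) ≤ 1 := Real.rpow_le_one ht.1 ht.2 h1a.le
    rw [add_zero]
    refine (abs_add_le _ _).trans (add_le_add ?_ ?_)
    · rw [abs_mul]
      exact mul_le_of_le_one_right (abs_nonneg _) ht1
    · rw [abs_of_nonneg (by positivity)]
      gcongr
  · refine (Finset.abs_sum_le_sum_abs _ _).trans ?_
    refine (Finset.sum_le_sum fun (k : ℕ) hk => abs_integral_mul_le (b := b)
      (by ring : (k + 1 : ℝ) + 1 = k + 2) (by positivity : (0 : ℝ) ≤ (k + 1 : ℝ) ^ (-(a + 1)))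
      (fun t ht => abs_kernel_le ha0 ha1 k ht) fun t ht => hb t ?_).trans ?_
    · have hkm : (k : ℝ) + 1 ≤ m := by exact_mod_cast Finset.mem_range.1 hk
      exact ⟨le_trans (by positivity) ht.1, ht.2.trans (by linarith)⟩
    · rw [← Finset.sum_mul]
      exact mul_le_mul_of_nonneg_right (hsum.sum_le_tsum _ fun k _ => by positivity) hb0
  · exact abs_integral_mul_le (by ring) (by positivity)
      (fun t ht => abs_last_kernel_le ha0 ha1 m ht)
      (fun t ht => hb t ⟨le_trans (by positivity) ht.1, ht.2⟩)

lemma caputo_eq {α x h N : ℝ} {y : ℝ → ℝ} (hα0 : 0 < α) (hα1 : α < 1) (hh : 0 < h) (hN : 0 ≤ N)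
    (hx : x = h * N) :
    caputo α y x = 1 / (Real.Gamma (-α) * h ^ α) *
      (1 / α * ∫ t in (0 : ℝ)..N, t ^ (-α) * (deriv y (x - h * t) * -h)) := by
  have hG : Real.Gamma (1 - α) = -α * Real.Gamma (-α) := by
    rw [← Real.Gamma_add_one (by linarith : -α ≠ 0)]
    congr 1
    ring
  have hG0 : Real.Gamma (-α) ≠ 0 := fun h0 => by
    rw [h0, mul_zero] at hG
    exact (Real.Gamma_pos_of_pos (by linarith : 0 < 1 - α)).ne' hG
  have hsub := intervalIntegral.integral_comp_sub_mul (a := 0) (b := N)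
    (fun t => deriv y t / (x - t) ^ α) hh.ne' x
  rw [mul_zero, sub_zero, ← hx, sub_self, smul_eq_mul] at hsub
  have hpt : ∫ t in (0 : ℝ)..N, deriv y (x - h * t) / (x - (x - h * t)) ^ α
      = ∫ t in (0 : ℝ)..N, -(1 / (h * h ^ α)) * (t ^ (-α) * (deriv y (x - h * t) * -h)) := by
    refine intervalIntegral.integral_congr fun t ht => ?_
    rw [Set.uIcc_of_le hN] at ht
    simp only [sub_sub_cancel]
    rw [Real.mul_rpow hh.le ht.1, Real.rpow_neg ht.1, div_eq_mul_inv, mul_inv]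
    field_simp
  rw [hpt, intervalIntegral.integral_const_mul] at hsub
  have hI : ∫ t in (0 : ℝ)..x, deriv y t / (x - t) ^ α
      = -(1 / h ^ α) * ∫ t in (0 : ℝ)..N, t ^ (-α) * (deriv y (x - h * t) * -h) := by
    rw [eq_comm, inv_mul_eq_iff_eq_mul₀ hh.ne'] at hsub
    rw [hsub]
    field_simp
  rw [caputo, hI, hG]
  generalize ∫ t in (0 : ℝ)..N, t ^ (-α) * (deriv y (x - h * t) * -h) = I
  field_simp

theorem approx_order_two_sub_alpha_power_neg_one_sub_alpha
    (α x : ℝ) (hα0 : 0 < α) (hα1 : α < 1) (hx : 0 < x)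
    (y : ℝ → ℝ) (hy : ContDiff ℝ (⊤ : ℕ∞) y) :
    ∃ C > 0, ∀ n : ℕ, 4 ≤ n →
      |(1 / (Real.Gamma (-α) * (x / n) ^ α)) *
          ((zr α - zr (1 + α)) * y x
            + (1 - zr α) * y (x - x / n)
            + (∑ k ∈ Finset.Icc 2 (n - 2), (k:ℝ) ^ (-1 - α) * y (x - (k:ℝ) * (x / n)))
            + (((n:ℝ) - 1) ^ (-1 - α) - (n:ℝ) * S n (α + 1) + S n α
                - (n:ℝ) ^ (1 - α) / (α * (1 - α))) * y (x - ((n:ℝ) - 1) * (x / n))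
            + (((n:ℝ) - 1) * S n (α + 1) - S n α
                + (n:ℝ) ^ (1 - α) / (α * (1 - α))) * y (x - (n:ℝ) * (x / n)))
        - caputo α y x|
      ≤ C * (x / n) ^ (2 - α) := by
  obtain ⟨C, hC, hbound⟩ := exists_quadrature_error_bound hα0 hα1
  have hG0 : Real.Gamma (-α) ≠ 0 := Real.Gamma_ne_zero fun k hk => by
    have h1 : (k : ℝ) < 1 := by linarith
    have h2 : k = 0 := by exact_mod_cast Nat.lt_one_iff.1 (by exact_mod_cast h1)
    simp [h2] at hk
    linarith
  have hy₀ : ∀ t, HasDerivAt y (deriv y t) t := fun t =>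
    (hy.differentiable (by simp) t).hasDerivAt
  have hy₁ : ContDiff ℝ (⊤ : ℕ∞) (deriv y) := (contDiff_infty_iff_deriv.1 hy).2
  have hy₂ : ∀ t, HasDerivAt (deriv y) (deriv (deriv y) t) t := fun t =>
    (hy₁.differentiable (by simp) t).hasDerivAt
  have hy₃ : Continuous (deriv (deriv y)) := (contDiff_infty_iff_deriv.1 hy₁).2.continuous
  obtain ⟨B, hB⟩ := (isCompact_Icc (a := 0) (b := x)).exists_bound_of_continuousOn
    hy₃.continuousOn
  have hB0 : 0 ≤ B := (norm_nonneg _).trans (hB 0 ⟨le_rfl, hx.le⟩)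
  refine ⟨1 / |Real.Gamma (-α)| * C * (B + 1), by positivity, fun n hn => ?_⟩
  obtain ⟨m, rfl⟩ : ∃ m, n = m + 1 + 2 := ⟨n - 3, by omega⟩
  set h : ℝ := x / ((m + 1 + 2 : ℕ) : ℝ) with hhdef
  have hn0 : (0 : ℝ) < ((m + 1 + 2 : ℕ) : ℝ) := by positivity
  have hh : 0 < h := by positivity
  have hxh : x = h * ((m + 1 : ℕ) + 2 : ℝ) := by
    rw [hhdef]
    push_cast
    field_simp
  have hlin : ∀ t, HasDerivAt (fun t => x - h * t) (-h) t := fun t => by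
    simpa using ((hasDerivAt_id t).const_mul h).const_sub x
  have hE := hbound (m + 1) (h ^ 2 * B) (fun t => y (x - h * t))
    (fun t => deriv y (x - h * t) * -h) (fun t => deriv (deriv y) (x - h * t) * -h * -h)
    (fun t => (hy₀ _).comp t (hlin t)) (fun t => ((hy₂ _).comp t (hlin t)).mul_const _)
    (by fun_prop) (fun t ht => by
      have hb := hB (x - h * t) ⟨by
        have := mul_le_mul_of_nonneg_left ht.2 hh.le
        linarith, by linarith [mul_nonneg hh.le ht.1]⟩
      rw [Real.norm_eq_abs] at hb
      rw [abs_mul, abs_mul, abs_neg, abs_of_pos hh]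
      nlinarith [sq_nonneg h])
  rw [caputo_eq hα0 hα1 hh (by positivity) hxh, ← mul_sub, abs_mul]
  have hsum : ∑ k ∈ Finset.Icc 2 (m + 1 + 2 - 2), (k : ℝ) ^ (-1 - α) * y (x - (k : ℝ) * h)
      = ∑ k ∈ Finset.range m, (k + 2 : ℝ) ^ (-(α + 1)) * y (x - h * (k + 2)) := by
    rw [Nat.add_sub_cancel, ← Finset.Ico_add_one_right_eq_Icc, Finset.sum_Ico_eq_sum_range]
    refine Finset.sum_congr (by simp) fun k _ => ?_
    push_cast
    rw [show -1 - α = -(α + 1) by ring, show (2 + k : ℝ) = k + 2 by ring, mul_comm h]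
  rw [hsum]
  refine (mul_le_mul_of_nonneg_left (LE.le.trans (Eq.le ?_) hE) (abs_nonneg _)).trans ?_
  · congr 1
    rw [Finset.sum_range_succ, lastWeight, show m + 1 + 2 = m + 3 by ring,
      show -1 - α = -(α + 1) by ring, add_comm 1 α]
    push_cast
    ring_nf
  · rw [abs_div, abs_one, abs_mul, abs_of_pos (Real.rpow_pos_of_pos hh α),
      Real.rpow_sub hh, Real.rpow_two]
    have hle : h ^ 2 * B ≤ h ^ 2 * (B + 1) := by gcongr; linarith
    calc 1 / (|Real.Gamma (-α)| * h ^ α) * (C * (h ^ 2 * B))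
        ≤ 1 / (|Real.Gamma (-α)| * h ^ α) * (C * (h ^ 2 * (B + 1))) := by gcongr
      _ = 1 / |Real.Gamma (-α)| * C * (B + 1) * (h ^ 2 / h ^ α) := by field_simp
end

section
/- (Fourth-order expansion of the Riemann-sum approximation.) Let 0 < α < 1, x > 0, and let y be smooth (C^∞) on [0, x]. Then there exists C > 0 (independent of n) such that for all integers n ≥ 2, with h = x/n, | Γ(−α) D^α y(x) − [ h^{−α} Σ_{k=1}^{n−1} y(x−kh)/k^{1+α} − ζ(1+α) y(x) h^{−α} + y(0)/(α x^α) + y(0) h/(2 x^{1+α}) + ζ(α) y'(x) h^{1−α} − (ζ(α−1)/2) y''(x) h^{2−α} + (ζ(α−2)/6) y'''(x) h^{3−α} − (ζ(α−3)/24) y^{(4)}(x) h^{4−α} + ((x y'(0) + (1+α) y(0))/(12 x^{2+α})) h² ] | ≤ C h⁴. -/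
section FractionalRiemannSum

open Filter Topology MeasureTheory

section

variable {E : Type*} [NormedAddCommGroup E] [NormedSpace ℝ E] [CompleteSpace E]

theorem norm_trapezoid_error_le {g₀ g₁ g₂ g₃ g₄ : ℝ → E} {a b : ℝ} (hab : a ≤ b)
    (h₀ : ∀ u ∈ Set.Icc a b, HasDerivAt g₀ (g₁ u) u)
    (h₁ : ∀ u ∈ Set.Icc a b, HasDerivAt g₁ (g₂ u) u)
    (h₂ : ∀ u ∈ Set.Icc a b, HasDerivAt g₂ (g₃ u) u)
    (h₃ : ∀ u ∈ Set.Icc a b, HasDerivAt g₃ (g₄ u) u)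
    (h₄ : ContinuousOn g₄ (Set.Icc a b))
    {φ : ℝ → ℝ} (hφ : ContinuousOn φ (Set.Icc a b)) (hφg : ∀ u ∈ Set.Icc a b, ‖g₄ u‖ ≤ φ u) :
    ‖(∫ u in a..b, g₀ u) - ((b - a) / 2) • (g₀ a + g₀ b) + ((b - a) ^ 2 / 12) • (g₁ b - g₁ a)‖
      ≤ (b - a) ^ 4 * ∫ u in a..b, φ u := by
  have hu : Set.uIcc a b = Set.Icc a b := Set.uIcc_of_le hab
  have c₀ : ContinuousOn g₀ (Set.uIcc a b) :=
    fun u m => (h₀ u (hu ▸ m)).continuousAt.continuousWithinAt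
  rw [← hu] at h₄ hφ
  have cp : ContinuousOn (fun u => ((u - a) ^ 2 * (b - u) ^ 2) • g₄ u) (Set.uIcc a b) :=
    ContinuousOn.smul (by fun_prop) h₄
  have c24 : ContinuousOn (fun u => (24 : ℝ) • g₀ u) (Set.uIcc a b) := c₀.const_smul _
  have key : (∫ u in a..b, (((u - a) ^ 2 * (b - u) ^ 2) • g₄ u - (24 : ℝ) • g₀ u)) =
      (2 * (b - a) ^ 2) • (g₁ b - g₁ a) - (12 * (b - a)) • (g₀ a + g₀ b) := by
    rw [intervalIntegral.integral_eq_sub_of_hasDerivAt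
      (f := fun u => ((u - a) ^ 2 * (b - u) ^ 2) • g₃ u
        - (2 * (u - a) * (b - u) ^ 2 - 2 * (u - a) ^ 2 * (b - u)) • g₂ u
        + (2 * (b - u) ^ 2 - 8 * (u - a) * (b - u) + 2 * (u - a) ^ 2) • g₁ u
        - (12 * (u - a) - 12 * (b - u)) • g₀ u)]
    · module
    · intro u m
      rw [hu] at m
      have d1 : HasDerivAt (fun u : ℝ => u - a) 1 u := (hasDerivAt_id u).sub_const a
      have d2 : HasDerivAt (fun u : ℝ => b - u) (-1) u := (hasDerivAt_id u).const_sub b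
      have e3 := ((d1.fun_pow 2).fun_mul (d2.fun_pow 2)).fun_smul (h₃ u m)
      have e2 := (((d1.const_mul 2).fun_mul (d2.fun_pow 2)).fun_sub
        (((d1.fun_pow 2).const_mul 2).fun_mul d2)).fun_smul (h₂ u m)
      have e1 := ((((d2.fun_pow 2).const_mul 2).fun_sub ((d1.const_mul 8).fun_mul d2)).fun_add
        ((d1.fun_pow 2).const_mul 2)).fun_smul (h₁ u m)
      have e0 := ((d1.const_mul 12).fun_sub (d2.const_mul 12)).fun_smul (h₀ u m)
      convert ((e3.fun_sub e2).fun_add e1).fun_sub e0 using 1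
      push_cast
      module
    · exact (cp.sub c24).intervalIntegrable
  rw [intervalIntegral.integral_sub cp.intervalIntegrable c24.intervalIntegrable,
    intervalIntegral.integral_smul] at key
  have e : (∫ u in a..b, g₀ u) - ((b - a) / 2) • (g₀ a + g₀ b)
      + ((b - a) ^ 2 / 12) • (g₁ b - g₁ a)
      = (1 / 24 : ℝ) • ∫ u in a..b, ((u - a) ^ 2 * (b - u) ^ 2) • g₄ u := by
    rw [eq_add_of_sub_eq key]
    module
  have bd : ‖∫ u in a..b, ((u - a) ^ 2 * (b - u) ^ 2) • g₄ u‖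
      ≤ ∫ u in a..b, (b - a) ^ 4 * φ u := by
    refine intervalIntegral.norm_integral_le_of_norm_le hab ?_
      (continuousOn_const.mul hφ).intervalIntegrable
    filter_upwards with u m
    have m' : u ∈ Set.Icc a b := ⟨m.1.le, m.2⟩
    have p1 : (u - a) ^ 2 ≤ (b - a) ^ 2 :=
      pow_le_pow_left₀ (sub_nonneg.2 m'.1) (by linarith [m'.2]) 2
    have p2 : (b - u) ^ 2 ≤ (b - a) ^ 2 :=
      pow_le_pow_left₀ (sub_nonneg.2 m'.2) (by linarith [m'.1]) 2
    rw [norm_smul, Real.norm_of_nonneg (by positivity)]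
    refine mul_le_mul ?_ (hφg u m') (norm_nonneg _) (by positivity)
    calc _ ≤ (b - a) ^ 2 * (b - a) ^ 2 := by gcongr
      _ = _ := by ring
  rw [e, norm_smul, ← intervalIntegral.integral_const_mul]
  refine le_trans ?_ bd
  rw [Real.norm_of_nonneg (by norm_num)]
  linarith [norm_nonneg (∫ u in a..b, ((u - a) ^ 2 * (b - u) ^ 2) • g₄ u)]

theorem norm_euler_maclaurin_error_le {g₀ g₁ g₂ g₃ g₄ : ℝ → E} {h : ℝ} (hh : 0 < h)
    {m N : ℕ} (hmN : m ≤ N)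
    (h₀ : ∀ u ∈ Set.Icc (m * h) (N * h), HasDerivAt g₀ (g₁ u) u)
    (h₁ : ∀ u ∈ Set.Icc (m * h) (N * h), HasDerivAt g₁ (g₂ u) u)
    (h₂ : ∀ u ∈ Set.Icc (m * h) (N * h), HasDerivAt g₂ (g₃ u) u)
    (h₃ : ∀ u ∈ Set.Icc (m * h) (N * h), HasDerivAt g₃ (g₄ u) u)
    (h₄ : ContinuousOn g₄ (Set.Icc (m * h) (N * h))) {φ : ℝ → ℝ}
    (hφ : ContinuousOn φ (Set.Icc (m * h) (N * h)))
    (hφg : ∀ u ∈ Set.Icc (m * h) (N * h), ‖g₄ u‖ ≤ φ u) :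
    ‖(∫ u in (m * h)..(N * h), g₀ u) - h • (∑ k ∈ Finset.Ico m N, g₀ (k * h))
        - (h / 2) • (g₀ (N * h) - g₀ (m * h)) + (h ^ 2 / 12) • (g₁ (N * h) - g₁ (m * h))‖
      ≤ h ^ 4 * ∫ u in (m * h)..(N * h), φ u := by
  induction N, hmN using Nat.le_induction with
  | base => simp
  | succ N hmN ih =>
    have hN1 : (N : ℝ) * h ≤ ((N + 1 : ℕ) : ℝ) * h := by push_cast; nlinarith
    have hmN' : (m : ℝ) * h ≤ N * h := by gcongr
    have s1 : Set.Icc ((m : ℝ) * h) (N * h) ⊆ Set.Icc (m * h) ((N + 1 : ℕ) * h) :=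
      Set.Icc_subset_Icc_right hN1
    have s2 : Set.Icc ((N : ℝ) * h) ((N + 1 : ℕ) * h) ⊆ Set.Icc (m * h) ((N + 1 : ℕ) * h) :=
      Set.Icc_subset_Icc_left hmN'
    have c₀ : ContinuousOn g₀ (Set.Icc (m * h) ((N + 1 : ℕ) * h)) :=
      fun u m => (h₀ u m).continuousAt.continuousWithinAt
    have i1 := ih (fun u k => h₀ u (s1 k)) (fun u k => h₁ u (s1 k)) (fun u k => h₂ u (s1 k))
      (fun u k => h₃ u (s1 k)) (h₄.mono s1) (hφ.mono s1) (fun u k => hφg u (s1 k))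
    have i2 := norm_trapezoid_error_le hN1 (fun u k => h₀ u (s2 k)) (fun u k => h₁ u (s2 k))
      (fun u k => h₂ u (s2 k)) (fun u k => h₃ u (s2 k)) (h₄.mono s2) (hφ.mono s2)
      (fun u k => hφg u (s2 k))
    have len : ((N + 1 : ℕ) : ℝ) * h - N * h = h := by push_cast; ring
    rw [len] at i2
    rw [← intervalIntegral.integral_add_adjacent_intervals (f := g₀) (b := N * h)
        ((Set.uIcc_of_le hmN' ▸ c₀.mono s1).intervalIntegrable)
        ((Set.uIcc_of_le hN1 ▸ c₀.mono s2).intervalIntegrable),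
      ← intervalIntegral.integral_add_adjacent_intervals (f := φ) (b := N * h)
        ((Set.uIcc_of_le hmN' ▸ hφ.mono s1).intervalIntegrable)
        ((Set.uIcc_of_le hN1 ▸ hφ.mono s2).intervalIntegrable),
      Finset.sum_Ico_succ_top hmN, mul_add]
    refine le_trans (le_of_eq ?_) (norm_add_le_of_le i1 i2)
    congr 1
    module
end
noncomputable def zetaApprox (n : ℕ) (s : ℂ) : ℂ :=
  ∑ k ∈ Finset.Ico 1 n, (k : ℂ) ^ (-s) - (n : ℂ) ^ (1 - s) / (1 - s) + (n : ℂ) ^ (-s) / 2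
    + s * (n : ℂ) ^ (-s - 1) / 12

theorem hasDerivAt_const_mul_ofReal_cpow (a c : ℂ) {u : ℝ} (hu : 0 < u) :
    HasDerivAt (fun t : ℝ => a * (t : ℂ) ^ c) (a * c * (u : ℂ) ^ (c - 1)) u := by
  have h := ((Complex.hasStrictDerivAt_cpow_const (x := (u : ℂ)) (c := c)
    (Complex.ofReal_mem_slitPlane.2 hu)).hasDerivAt.comp_ofReal).const_mul a
  rwa [← mul_assoc] at h

theorem norm_zetaApprox_sub_le {s : ℂ} (hs : -3 < s.re) (hs1 : s ≠ 1) {n N : ℕ} (hn : 0 < n)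
    (hnN : n ≤ N) :
    ‖zetaApprox N s - zetaApprox n s‖
      ≤ ‖s * (s + 1) * (s + 2) * (s + 3)‖ / (s.re + 3) * (n : ℝ) ^ (-s.re - 3) := by
  have hn' : (0 : ℝ) < n := by exact_mod_cast hn
  have hN' : (n : ℝ) ≤ N := by exact_mod_cast hnN
  have pos : ∀ u ∈ Set.Icc ((n : ℝ) * 1) (N * 1), 0 < u := fun u m => by
    rw [mul_one] at m; exact hn'.trans_le m.1
  have em := norm_euler_maclaurin_error_le (h := 1) one_pos hnN
    (g₀ := fun u : ℝ => 1 * (u : ℂ) ^ (-s)) (g₁ := fun u : ℝ => 1 * (-s) * (u : ℂ) ^ (-s - 1))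
    (g₂ := fun u : ℝ => 1 * (-s) * (-s - 1) * (u : ℂ) ^ (-s - 1 - 1))
    (g₃ := fun u : ℝ => 1 * (-s) * (-s - 1) * (-s - 1 - 1) * (u : ℂ) ^ (-s - 1 - 1 - 1))
    (g₄ := fun u : ℝ => 1 * (-s) * (-s - 1) * (-s - 1 - 1) * (-s - 1 - 1 - 1) *
      (u : ℂ) ^ (-s - 1 - 1 - 1 - 1))
    (φ := fun u => ‖s * (s + 1) * (s + 2) * (s + 3)‖ * u ^ (-s.re - 4))
    (fun u m => hasDerivAt_const_mul_ofReal_cpow _ _ (pos u m))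
    (fun u m => hasDerivAt_const_mul_ofReal_cpow _ _ (pos u m))
    (fun u m => hasDerivAt_const_mul_ofReal_cpow _ _ (pos u m))
    (fun u m => hasDerivAt_const_mul_ofReal_cpow _ _ (pos u m))
    (fun u m => (hasDerivAt_const_mul_ofReal_cpow _ _
      (pos u m)).continuousAt.continuousWithinAt)
    (fun u m => (continuousAt_const.mul
      (Real.continuousAt_rpow_const _ _ (Or.inl (pos u m).ne'))).continuousWithinAt)
    (fun u m => by
      rw [norm_mul, Complex.norm_cpow_eq_rpow_re_of_pos (pos u m)]
      refine le_of_eq ?_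
      congr 1
      · congr 1; ring
      · congr 1; simp; ring)
  have zn : (0 : ℝ) ∉ Set.uIcc (n : ℝ) N := by
    rw [Set.uIcc_of_le hN']; exact fun h => absurd h.1 (not_le.2 hn')
  simp only [mul_one, one_mul, one_pow, one_smul] at em
  rw [integral_cpow (Or.inr ⟨fun h => hs1 (neg_injective h), zn⟩),
    intervalIntegral.integral_const_mul, integral_rpow (Or.inr ⟨by linarith, zn⟩)] at em
  have e : zetaApprox N s - zetaApprox n s = -(((N : ℝ) : ℂ) ^ (-s + 1) - ((n : ℝ) : ℂ) ^ (-s + 1))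
      / (-s + 1) + ∑ k ∈ Finset.Ico n N, ((k : ℝ) : ℂ) ^ (-s)
      + (1 / 2 : ℝ) • (((N : ℝ) : ℂ) ^ (-s) - ((n : ℝ) : ℂ) ^ (-s))
      - (1 / 12 : ℝ) • (-s * ((N : ℝ) : ℂ) ^ (-s - 1) - -s * ((n : ℝ) : ℂ) ^ (-s - 1)) := by
    have hsum := Finset.sum_Ico_consecutive (fun k : ℕ => (k : ℂ) ^ (-s)) (Nat.succ_le_of_lt hn) hnN
    simp only [Complex.ofReal_natCast]
    rw [zetaApprox, zetaApprox, ← hsum, Complex.real_smul, Complex.real_smul,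
      show 1 - s = -s + 1 by ring]
    push_cast
    ring
  rw [e, ← norm_neg]
  refine le_trans (le_of_eq ?_) (em.trans ?_)
  · congr 1; rw [neg_div]; module
  · have p : (0 : ℝ) ≤ (N : ℝ) ^ (-s.re - 3) := by positivity
    have q : 0 < s.re + 3 := by linarith
    rw [show -s.re - 4 + 1 = -(s.re + 3) by ring, div_neg, ← neg_div, neg_sub,
      div_mul_eq_mul_div, mul_div_assoc, show -(s.re + 3) = -s.re - 3 by ring]
    gcongr
    linarith

theorem differentiableAt_zetaApprox (n : ℕ) (hn : 0 < n) {s : ℂ} (hs : s ≠ 1) :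
    DifferentiableAt ℂ (zetaApprox n) s := by
  have pw : ∀ k : ℕ, 0 < k → ∀ g : ℂ → ℂ, DifferentiableAt ℂ g s →
      DifferentiableAt ℂ (fun s => (k : ℂ) ^ (g s)) s := fun k hk g hg =>
    hg.const_cpow (Or.inl (by exact_mod_cast hk.ne'))
  have hs' : 1 - s ≠ 0 := sub_ne_zero.2 hs.symm
  have h1 : DifferentiableAt ℂ (fun s => ∑ k ∈ Finset.Ico 1 n, (k : ℂ) ^ (-s)) s :=
    DifferentiableAt.fun_sum fun k hk => pw k (Finset.mem_Ico.1 hk).1 _ (by fun_prop)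
  exact ((h1.sub ((pw n hn _ (by fun_prop)).div (by fun_prop) hs')).add
    ((pw n hn _ (by fun_prop)).div_const _)).add
    ((differentiableAt_id.mul (pw n hn _ (by fun_prop))).div_const _)

theorem tendsto_natCast_cpow_zero {c : ℂ} (hc : c.re < 0) :
    Tendsto (fun n : ℕ => (n : ℂ) ^ c) atTop (𝓝 0) := by
  rw [tendsto_zero_iff_norm_tendsto_zero]
  have := (tendsto_rpow_neg_atTop (neg_pos.2 hc)).comp tendsto_natCast_atTop_atTop
  refine this.congr' ?_
  filter_upwards [eventually_gt_atTop 0] with n hn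
  rw [Complex.norm_natCast_cpow_of_pos hn, Function.comp_apply, neg_neg]

theorem tendsto_zetaApprox_of_one_lt_re {s : ℂ} (hs : 1 < s.re) :
    Tendsto (fun n => zetaApprox n s) atTop (𝓝 (riemannZeta s)) := by
  have hs0 : -s ≠ 0 := by
    intro h; rw [neg_eq_zero] at h; subst h; norm_num at hs
  have h0 : Tendsto (fun n : ℕ => ∑ k ∈ Finset.range n, 1 / (k : ℂ) ^ s) atTop
      (𝓝 (riemannZeta s)) := by
    rw [zeta_eq_tsum_one_div_nat_cpow hs]
    exact (Complex.summable_one_div_nat_cpow.2 hs).hasSum.tendsto_sum_nat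
  have h1 : Tendsto (fun n : ℕ => ∑ k ∈ Finset.Ico 1 n, (k : ℂ) ^ (-s)) atTop
      (𝓝 (riemannZeta s)) := by
    refine h0.congr' ?_
    filter_upwards [eventually_gt_atTop 0] with n hn
    rw [Finset.range_eq_Ico, Finset.sum_eq_sum_Ico_succ_bot hn]
    simp [Complex.cpow_neg, neg_ne_zero.1 hs0]
  have h2 := (tendsto_natCast_cpow_zero (c := 1 - s) (by simpa using hs)).div_const (1 - s)
  have h3 := (tendsto_natCast_cpow_zero (c := -s) (by simp; linarith)).div_const 2
  have h4 := ((tendsto_natCast_cpow_zero (c := -s - 1) (by simp; linarith)).const_mul s).div_const 12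
  simpa [zetaApprox] using ((h1.sub h2).add h3).add h4

theorem isPreconnected_re_gt_diff_one :
    IsPreconnected {s : ℂ | -3 < s.re ∧ s ≠ 1} := by
  have hA : IsPreconnected {s : ℂ | 1 < s.re} := (convex_halfSpace_re_gt 1).isPreconnected
  have hB : IsPreconnected ({s : ℂ | -3 < s.re} ∩ {s : ℂ | 0 < s.im}) :=
    ((convex_halfSpace_re_gt _).inter (convex_halfSpace_im_gt 0)).isPreconnected
  have hC : IsPreconnected ({s : ℂ | -3 < s.re} ∩ {s : ℂ | s.im < 0}) :=
    ((convex_halfSpace_re_gt _).inter (convex_halfSpace_im_lt 0)).isPreconnected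
  have hD : IsPreconnected ({s : ℂ | -3 < s.re} ∩ {s : ℂ | s.re < 1}) :=
    ((convex_halfSpace_re_gt _).inter (convex_halfSpace_re_lt 1)).isPreconnected
  have hAB := hA.union (2 + Complex.I) (by simp) (by simp; norm_num) hB
  have hABC := hAB.union (2 - Complex.I) (by left; simp) (by simp; norm_num) hC
  have hABCD := hABC.union Complex.I (by left; right; simp) (by simp) hD
  convert hABCD using 1
  ext s
  simp only [Set.mem_ofPred_eq, Set.mem_union, Set.mem_inter_iff, ne_eq, Complex.ext_iff,
    Complex.one_re, Complex.one_im]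
  constructor
  · rintro ⟨h, h1⟩
    rcases lt_trichotomy s.re 1 with h2 | h2 | h2
    · exact Or.inr ⟨h, h2⟩
    · rcases lt_trichotomy s.im 0 with h3 | h3 | h3
      · exact Or.inl (Or.inr ⟨h, h3⟩)
      · exact absurd ⟨h2, h3⟩ h1
      · exact Or.inl (Or.inl (Or.inr ⟨h, h3⟩))
    · exact Or.inl (Or.inl (Or.inl h2))
  · rintro (((h | h) | h) | h)
    · exact ⟨by linarith, fun e => by linarith [e.1]⟩
    · exact ⟨h.1, fun e => by linarith [e.2, h.2]⟩
    · exact ⟨h.1, fun e => by linarith [e.2, h.2]⟩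
    · exact ⟨h.1, fun e => by linarith [e.1, h.2]⟩

theorem tendsto_zetaApprox {s : ℂ} (hs : -3 < s.re) (hs1 : s ≠ 1) :
    Tendsto (fun n => zetaApprox n s) atTop (𝓝 (riemannZeta s)) := by
  set U : Set ℂ := {s : ℂ | -3 < s.re ∧ s ≠ 1} with hU
  have Uo : IsOpen U :=
    (isOpen_lt continuous_const Complex.continuous_re).inter isOpen_ne
  have small : ∀ s : ℂ, -3 < s.re → Tendsto (fun n : ℕ =>
      ‖s * (s + 1) * (s + 2) * (s + 3)‖ / (s.re + 3) * (n : ℝ) ^ (-s.re - 3)) atTop (𝓝 0) := by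
    intro s hs
    have := ((tendsto_rpow_neg_atTop (y := s.re + 3) (by linarith)).comp
      tendsto_natCast_atTop_atTop).const_mul (‖s * (s + 1) * (s + 2) * (s + 3)‖ / (s.re + 3))
    rw [mul_zero] at this
    refine this.congr fun n => ?_
    simp only [Function.comp_apply]
    congr 2; ring
  have lim : ∀ s : ℂ, ∃ z, s ∈ U → Tendsto (fun n => zetaApprox n s) atTop (𝓝 z) := by
    intro s
    by_cases hs : s ∈ U
    · have : CauchySeq (fun n => zetaApprox n s) := by
        rw [Metric.cauchySeq_iff']
        intro ε hε
        obtain ⟨n, hn, hn0⟩ := (((small s hs.1).eventually_lt_const hε).and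
          (eventually_gt_atTop 0)).exists
        exact ⟨n, fun N hN => by
          rw [dist_eq_norm]
          exact (norm_zetaApprox_sub_le hs.1 hs.2 hn0 hN).trans_lt hn⟩
      obtain ⟨z, hz⟩ := cauchySeq_tendsto_of_complete this
      exact ⟨z, fun _ => hz⟩
    · exact ⟨0, fun h => absurd h hs⟩
  choose Z hZ using lim
  have bound : ∀ s ∈ U, ∀ n : ℕ, 0 < n → ‖Z s - zetaApprox n s‖
      ≤ ‖s * (s + 1) * (s + 2) * (s + 3)‖ / (s.re + 3) * (n : ℝ) ^ (-s.re - 3) := by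
    intro s hs n hn
    refine le_of_tendsto ((hZ s hs).sub_const _).norm ?_
    filter_upwards [eventually_ge_atTop n] with N hN
    exact norm_zetaApprox_sub_le hs.1 hs.2 hn hN
  have unif : TendstoLocallyUniformlyOn zetaApprox Z atTop U := by
    rw [tendstoLocallyUniformlyOn_iff_forall_isCompact Uo]
    intro K hKU hK
    rcases K.eq_empty_or_nonempty with rfl | hne
    · exact tendstoUniformlyOn_empty
    obtain ⟨s₀, hs₀, hmin⟩ := hK.exists_isMinOn hne Complex.continuous_re.continuousOn
    have hc : ContinuousOn (fun s : ℂ => ‖s * (s + 1) * (s + 2) * (s + 3)‖ / (s.re + 3)) K :=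
      ContinuousOn.div (by fun_prop) (by fun_prop) fun s hs => by
        have := (hKU hs).1
        linarith
    obtain ⟨B, hB⟩ := hK.bddAbove_image hc
    have lim0 := ((tendsto_rpow_neg_atTop (y := s₀.re + 3)
      (by linarith [(hKU hs₀).1])).comp tendsto_natCast_atTop_atTop).const_mul B
    rw [mul_zero] at lim0
    rw [Metric.tendstoUniformlyOn_iff]
    intro ε hε
    filter_upwards [lim0.eventually_lt_const hε, eventually_gt_atTop 0] with n hn hn0 s hs
    rw [dist_eq_norm]
    refine (bound s (hKU hs) n hn0).trans_lt (lt_of_le_of_lt ?_ hn)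
    have q : 0 < s.re + 3 := by linarith [(hKU hs).1]
    have hBs := hB (Set.mem_image_of_mem _ hs)
    have hn1 : (1 : ℝ) ≤ n := by exact_mod_cast hn0
    have hm : s₀.re ≤ s.re := hmin hs
    have hB0 : 0 ≤ B := le_trans (by positivity) hBs
    simp only [Function.comp_apply]
    gcongr
    linarith
  have dZ : DifferentiableOn ℂ Z U := unif.differentiableOn (by
    filter_upwards [eventually_gt_atTop 0] with n hn s hs
    exact (differentiableAt_zetaApprox n hn hs.2).differentiableWithinAt) Uo
  have dζ : DifferentiableOn ℂ riemannZeta U := fun s hs =>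
    (differentiableAt_riemannZeta hs.2).differentiableWithinAt
  have two : (2 : ℂ) ∈ U := ⟨by norm_num, by norm_num⟩
  have eq2 : Z =ᶠ[𝓝 2] riemannZeta := by
    filter_upwards [(isOpen_lt continuous_const Complex.continuous_re).mem_nhds
      (show (1 : ℝ) < (2 : ℂ).re by norm_num)] with s hs
    have hs : 1 < s.re := hs
    exact tendsto_nhds_unique (hZ s ⟨by linarith, fun h => by simp [h] at hs⟩)
      (tendsto_zetaApprox_of_one_lt_re hs)
  have := (dZ.analyticOnNhd Uo).eqOn_of_preconnected_of_eventuallyEq (dζ.analyticOnNhd Uo)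
    isPreconnected_re_gt_diff_one two eq2 ⟨hs, hs1⟩
  exact this ▸ hZ s ⟨hs, hs1⟩

theorem exists_abs_zeta_sub_le {s : ℝ} (hs : -3 < s) (hs1 : s ≠ 1) :
    ∃ C : ℝ, 0 ≤ C ∧ ∀ n : ℕ, 0 < n →
      |zr s - (∑ k ∈ Finset.Ico 1 n, (k : ℝ) ^ (-s) - (n : ℝ) ^ (1 - s) / (1 - s)
        + (n : ℝ) ^ (-s) / 2 + s * (n : ℝ) ^ (-s - 1) / 12)| ≤ C * (n : ℝ) ^ (-s - 3) := by
  have h3 : 0 < s + 3 := by linarith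
  refine ⟨‖(s : ℂ) * (s + 1) * (s + 2) * (s + 3)‖ / (s + 3), by positivity, fun n hn => ?_⟩
  have hs1' : (s : ℂ) ≠ 1 := by exact_mod_cast hs1
  have lim := ((tendsto_zetaApprox (s := s) (by simpa using hs) hs1').sub_const
    (zetaApprox n s)).norm
  have b : ‖riemannZeta s - zetaApprox n s‖ ≤ _ := le_of_tendsto lim (by
    filter_upwards [eventually_ge_atTop n] with N hN
    exact norm_zetaApprox_sub_le (by simpa using hs) hs1' hn hN)
  have e : zetaApprox n s = ((∑ k ∈ Finset.Ico 1 n, (k : ℝ) ^ (-s) - (n : ℝ) ^ (1 - s) / (1 - s)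
        + (n : ℝ) ^ (-s) / 2 + s * (n : ℝ) ^ (-s - 1) / 12 : ℝ) : ℂ) := by
    have cast : ∀ (k : ℕ) (t : ℝ), (((k : ℝ) ^ t : ℝ) : ℂ) = (k : ℂ) ^ (t : ℂ) := fun k t => by
      rw [Complex.ofReal_cpow k.cast_nonneg, Complex.ofReal_natCast]
    simp only [Complex.ofReal_add, Complex.ofReal_sub, Complex.ofReal_div, Complex.ofReal_mul,
      Complex.ofReal_sum, cast, zetaApprox]
    push_cast
    rfl
  rw [Complex.ofReal_re] at b
  refine le_trans ?_ b
  have := Complex.abs_re_le_norm (riemannZeta s - zetaApprox n s)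
  rwa [Complex.sub_re, e, Complex.ofReal_re, ← e] at this

/-- The error of the second-order endpoint-corrected Riemann sum for the (Caputo-regularized)
integral of `F u / u ^ (1 + α)` over `[0, x]`, before any correction at the singular endpoint. -/
noncomputable def expansionError (α x : ℝ) (n : ℕ) (F F' : ℝ → ℝ) : ℝ :=
  1 / α * (∫ u in (0 : ℝ)..x, F' u * u ^ (-α))
    - ((x / n) ^ (-α) * (∑ k ∈ Finset.Ico 1 n, F (k * (x / n)) * (k : ℝ) ^ (-(1 + α)))
      + F x * x ^ (-α) / α + F x * (x / n) * x ^ (-(1 + α)) / 2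
      + ((1 + α) * F x - x * F' x) * x ^ (-(2 + α)) / 12 * (x / n) ^ 2)

theorem intervalIntegrable_mul_rpow_neg {α : ℝ} (hα : α < 1) {F : ℝ → ℝ} (hF : Continuous F)
    (a b : ℝ) : IntervalIntegrable (fun u => F u * u ^ (-α)) volume a b :=
  (intervalIntegral.intervalIntegrable_rpow' (by linarith)).continuousOn_mul hF.continuousOn

theorem expansionError_add_const_mul {α : ℝ} (hα : α < 1) (x : ℝ) (n : ℕ) (a : ℝ)
    {F F' G G' : ℝ → ℝ} (hF : Continuous F') (hG : Continuous G') :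
    expansionError α x n (fun u => F u + a * G u) (fun u => F' u + a * G' u)
      = expansionError α x n F F' + a * expansionError α x n G G' := by
  have i : (∫ u in (0 : ℝ)..x, (F' u + a * G' u) * u ^ (-α))
      = (∫ u in (0 : ℝ)..x, F' u * u ^ (-α)) + a * ∫ u in (0 : ℝ)..x, G' u * u ^ (-α) := by
    rw [← intervalIntegral.integral_const_mul, ← intervalIntegral.integral_add
      (intervalIntegrable_mul_rpow_neg hα hF 0 x)
      ((intervalIntegrable_mul_rpow_neg hα hG 0 x).const_mul a)]
    congr 1; ext u; ring
  simp only [expansionError]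
  rw [i]
  simp only [add_mul, Finset.sum_add_distrib, mul_assoc, ← Finset.mul_sum]
  ring

theorem integral_natCast_mul_pow_mul_rpow_neg {α x : ℝ} (hα : α < 1) (hx : 0 < x)
    (j : ℕ) : (∫ u in (0 : ℝ)..x, ((j : ℝ) * u ^ (j - 1)) * u ^ (-α))
      = j / (j - α) * x ^ (j - α) := by
  rcases j with _ | j
  · simp
  · have hj : (0 : ℝ) ≤ j := j.cast_nonneg
    have e : (∫ u in (0 : ℝ)..x, (((j + 1 : ℕ) : ℝ) * u ^ (j + 1 - 1)) * u ^ (-α))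
        = ∫ u in (0 : ℝ)..x, ((j + 1 : ℕ) : ℝ) * u ^ (j - α) := by
      refine intervalIntegral.integral_congr_ae ?_
      filter_upwards with u hu
      rw [Set.uIoc_of_le hx.le] at hu
      rw [Nat.add_sub_cancel, mul_assoc, sub_eq_add_neg, Real.rpow_add hu.1, Real.rpow_natCast]
    rw [e, intervalIntegral.integral_const_mul, integral_rpow (Or.inl (by linarith)),
      Real.zero_rpow (by linarith)]
    push_cast
    rw [show (j : ℝ) - α + 1 = j + 1 - α by ring]
    ring

theorem exists_abs_expansionError_pow_le {α x : ℝ} (hα0 : 0 < α) (hα1 : α < 1) (hx : 0 < x)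
    {j : ℕ} (hj : j ≤ 4) :
    ∃ C : ℝ, 0 ≤ C ∧ ∀ n : ℕ, 0 < n →
      |expansionError α x n (fun u => u ^ j) (fun u => (j : ℝ) * u ^ (j - 1))
        + zr (1 + α - j) * (x / n) ^ (j - α)| ≤ C * (x / n) ^ 4 := by
  have hj4 : (j : ℝ) ≤ 4 := by exact_mod_cast hj
  have hjα : (j : ℝ) - α ≠ 0 := by
    rcases Nat.eq_zero_or_pos j with rfl | h
    · simpa using hα0.ne'
    · have : (1 : ℝ) ≤ j := by exact_mod_cast h
      linarith
  obtain ⟨C, hC, hb⟩ := exists_abs_zeta_sub_le (s := 1 + α - j) (by linarith)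
    (fun h => hjα (by linarith))
  refine ⟨C * x ^ (-(1 + α - j) - 3), by positivity, fun n hn => ?_⟩
  have hn' : (0 : ℝ) < n := by exact_mod_cast hn
  obtain ⟨h, hh⟩ : ∃ h, h = x / n := ⟨_, rfl⟩
  have h0 : 0 < h := hh ▸ div_pos hx hn'
  have hxh : x = n * h := by rw [hh]; field_simp
  have sm : h ^ (-α) * (∑ k ∈ Finset.Ico 1 n, ((k : ℝ) * h) ^ j * (k : ℝ) ^ (-(1 + α)))
      = h ^ (j - α) * ∑ k ∈ Finset.Ico 1 n, (k : ℝ) ^ (-(1 + α - j)) := by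
    rw [Finset.mul_sum, Finset.mul_sum]
    refine Finset.sum_congr rfl fun k hk => ?_
    have hk' : (0 : ℝ) < k := by exact_mod_cast (Finset.mem_Ico.1 hk).1
    rw [show (j : ℝ) - α = j + -α by ring, show -(1 + α - (j : ℝ)) = j + -(1 + α) by ring,
      Real.rpow_add h0, Real.rpow_add hk', Real.rpow_natCast, Real.rpow_natCast]
    ring
  have xp : ∀ t : ℝ, x ^ j * x ^ t = x ^ (j + t) := fun t => by
    rw [Real.rpow_add hx, Real.rpow_natCast]
  have xj : x * ((j : ℝ) * x ^ (j - 1)) = j * x ^ j := by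
    rcases j with _ | j
    · simp
    · rw [Nat.add_sub_cancel]; ring
  have xn : ∀ t : ℝ, x ^ t = (n : ℝ) ^ t * h ^ t := fun t => by
    rw [hxh, Real.mul_rpow hn'.le h0.le]
  have h1 : h * h ^ (-(1 + α - j)) = h ^ (j - α) := by
    rw [← Real.rpow_one_add' h0.le] <;> ring_nf
    contrapose! hjα; linarith
  have h2 : h ^ 2 * h ^ (-(1 + α - j) - 1) = h ^ (j - α) := by
    rw [← Real.rpow_natCast, ← Real.rpow_add h0]; congr 1; push_cast; ring
  have h4 : h ^ (j - α) = h ^ 4 * h ^ (-(1 + α - j) - 3) := by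
    rw [← Real.rpow_natCast h 4, ← Real.rpow_add h0]; congr 1; push_cast; ring
  have key : expansionError α x n (fun u => u ^ j) (fun u => (j : ℝ) * u ^ (j - 1))
        + zr (1 + α - j) * (x / n) ^ (j - α)
      = h ^ (j - α) * (zr (1 + α - j) - (∑ k ∈ Finset.Ico 1 n, (k : ℝ) ^ (-(1 + α - j))
        - (n : ℝ) ^ (1 - (1 + α - j)) / (1 - (1 + α - j))
        + (n : ℝ) ^ (-(1 + α - j)) / 2 + (1 + α - j) * (n : ℝ) ^ (-(1 + α - j) - 1) / 12)) := by
    rw [expansionError, integral_natCast_mul_pow_mul_rpow_neg hα1 hx, ← hh, sm, xj,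
      mul_right_comm (x ^ j) h, xp, xp, ← sub_mul, mul_assoc (1 + α - (j : ℝ)), xp,
      show (j : ℝ) + -(1 + α) = -(1 + α - j) by ring,
      show (j : ℝ) + -(2 + α) = -(1 + α - j) - 1 by ring, ← sub_eq_add_neg,
      show 1 - (1 + α - (j : ℝ)) = j - α by ring, xn (j - α), xn (-(1 + α - j)),
      xn (-(1 + α - j) - 1)]
    have e1 : (j : ℝ) / (j - α) = 1 + α / (j - α) := by field_simp; ring
    rw [e1]
    have e2 : 1 / α * ((1 + α / (j - α)) * ((n : ℝ) ^ (j - α) * h ^ (j - α)))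
        = (n : ℝ) ^ (j - α) * h ^ (j - α) / α + (n : ℝ) ^ (j - α) * h ^ (j - α) / (j - α) := by
      field_simp
    rw [e2]
    linear_combination -(n : ℝ) ^ (-(1 + α - j)) / 2 * h1
      - (1 + α - j) * (n : ℝ) ^ (-(1 + α - j) - 1) / 12 * h2
  rw [key, abs_mul, abs_of_pos (Real.rpow_pos_of_pos h0 _), ← hh]
  calc _ ≤ h ^ (j - α) * (C * (n : ℝ) ^ (-(1 + α - j) - 3)) := by gcongr; exact hb n hn
    _ = _ := by rw [h4, xn]; ring

theorem abs_le_mul_pow_succ_of_hasDerivAt {r r' : ℝ → ℝ} {M x : ℝ} {k : ℕ} (hM : 0 ≤ M)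
    (hr : ∀ u, HasDerivAt r (r' u) u) (r0 : r 0 = 0)
    (hb : ∀ u ∈ Set.Icc 0 x, |r' u| ≤ M * u ^ k) :
    ∀ u ∈ Set.Icc 0 x, |r u| ≤ M * u ^ (k + 1) := by
  intro u hu
  have := Convex.norm_image_sub_le_of_norm_hasDerivWithin_le (f := r) (f' := r') (s := Set.Icc 0 u)
    (x := 0) (y := u) (C := M * u ^ k) (fun t _ => (hr t).hasDerivWithinAt)
    (fun t ht => (hb t ⟨ht.1, ht.2.trans hu.2⟩).trans
      (mul_le_mul_of_nonneg_left (pow_le_pow_left₀ ht.1 ht.2 k) hM))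
    (convex_Icc _ _) ⟨le_rfl, hu.1⟩ ⟨hu.1, le_rfl⟩
  rw [r0, sub_zero, sub_zero, Real.norm_eq_abs, Real.norm_eq_abs, abs_of_nonneg hu.1] at this
  rwa [pow_succ, ← mul_assoc]

theorem exists_abs_expansionError_remainder_le {α x : ℝ} (hα0 : 0 < α) (hα1 : α < 1) (hx : 0 < x)
    {r₀ r₁ r₂ r₃ r₄ r₅ : ℝ → ℝ}
    (d₀ : ∀ u, HasDerivAt r₀ (r₁ u) u) (d₁ : ∀ u, HasDerivAt r₁ (r₂ u) u)
    (d₂ : ∀ u, HasDerivAt r₂ (r₃ u) u) (d₃ : ∀ u, HasDerivAt r₃ (r₄ u) u)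
    (d₄ : ∀ u, HasDerivAt r₄ (r₅ u) u) (c₅ : Continuous r₅)
    (z₀ : r₀ 0 = 0) (z₁ : r₁ 0 = 0) (z₂ : r₂ 0 = 0) (z₃ : r₃ 0 = 0) (z₄ : r₄ 0 = 0) :
    ∃ C : ℝ, 0 ≤ C ∧ ∀ n : ℕ, 0 < n → |expansionError α x n r₀ r₁| ≤ C * (x / n) ^ 4 := by
  obtain ⟨M, hM⟩ := isCompact_Icc.exists_bound_of_continuousOn (s := Set.Icc 0 x) c₅.continuousOn
  have M0 : 0 ≤ M := (norm_nonneg _).trans (hM 0 ⟨le_rfl, hx.le⟩)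
  have b₄ := abs_le_mul_pow_succ_of_hasDerivAt (k := 0) M0 d₄ z₄
    (fun u hu => by simpa using hM u hu)
  have b₃ := abs_le_mul_pow_succ_of_hasDerivAt M0 d₃ z₃ b₄
  have b₂ := abs_le_mul_pow_succ_of_hasDerivAt M0 d₂ z₂ b₃
  have b₁ := abs_le_mul_pow_succ_of_hasDerivAt M0 d₁ z₁ b₂
  have b₀ := abs_le_mul_pow_succ_of_hasDerivAt M0 d₀ z₀ b₁
  norm_num only at b₀ b₁ b₂ b₃ b₄
  have cont : ∀ {r r' : ℝ → ℝ}, (∀ u, HasDerivAt r (r' u) u) → Continuous r := fun d =>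
    continuous_iff_continuousAt.2 fun u => (d u).continuousAt
  set q : ℝ := -(1 + α) with hq
  set p : ℕ → ℝ → ℝ := fun i u => (∏ m ∈ Finset.range i, (q - m)) * u ^ (q - i) with hp
  have dp : ∀ i u, 0 < u → HasDerivAt (p i) (p (i + 1) u) u := fun i u hu => by
    refine ((Real.hasDerivAt_rpow_const (p := q - i) (Or.inl hu.ne')).const_mul
      (∏ m ∈ Finset.range i, (q - m))).congr_deriv ?_
    simp only [hp]
    rw [Finset.prod_range_succ, mul_assoc]
    congr 3
    push_cast; ring
  have bp : ∀ i ≤ 4, ∀ u, 0 < u → |p i u| ≤ 6 ^ 4 * u ^ (q - i) := fun i hi u hu => by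
    simp only [hp]
    rw [abs_mul, abs_of_pos (Real.rpow_pos_of_pos hu _), Finset.abs_prod]
    gcongr
    calc ∏ m ∈ Finset.range i, |q - m| ≤ ∏ m ∈ Finset.range i, (6 : ℝ) := by
          refine Finset.prod_le_prod (fun _ _ => abs_nonneg _) fun m hm => ?_
          have h1 : (m : ℝ) < 4 := by
            exact_mod_cast (Finset.mem_range.1 hm).trans_le hi
          have h2 : (0 : ℝ) ≤ m := m.cast_nonneg
          rw [abs_le]; constructor <;> linarith
      _ = 6 ^ i := by simp
      _ ≤ 6 ^ 4 := pow_le_pow_right₀ (by norm_num) hi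
  have brp : ∀ (i k : ℕ) (t : ℝ) (r : ℝ → ℝ), i ≤ 4 →
      (∀ u ∈ Set.Icc 0 x, |r u| ≤ M * u ^ k) → (k : ℝ) + q - i = t → ∀ u, 0 < u → u ≤ x →
      |r u * p i u| ≤ M * 6 ^ 4 * u ^ t := fun i k t r hi hr ht u hu hux => by
    rw [abs_mul]
    calc _ ≤ (M * u ^ k) * (6 ^ 4 * u ^ (q - i)) := by
          gcongr
          · exact hr u ⟨hu.le, hux⟩
          · exact bp i hi u hu
      _ = _ := by
          rw [← ht, add_sub_assoc, Real.rpow_add hu, Real.rpow_natCast]; ring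
  refine ⟨16 * (M * 6 ^ 4) * (x ^ (1 - α) / (1 - α)) + (M * 6 ^ 4) * x ^ (1 - α) * (2 / α + 1),
    ?_, fun n hn => ?_⟩
  · have : 0 < 1 - α := by linarith
    positivity
  have hn' : (0 : ℝ) < n := by exact_mod_cast hn
  obtain ⟨h, hh⟩ : ∃ h, h = x / n := ⟨_, rfl⟩
  have h0 : 0 < h := hh ▸ div_pos hx hn'
  have hxh : x = n * h := by rw [hh]; field_simp
  have hhx : h ≤ x := by
    rw [hh]; exact div_le_self hx.le (by exact_mod_cast hn)
  have pos : ∀ u ∈ Set.Icc (((1 : ℕ) : ℝ) * h) (n * h), 0 < u := fun u m => by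
    rw [Nat.cast_one, one_mul] at m; exact h0.trans_le m.1
  have lex : ∀ u ∈ Set.Icc (((1 : ℕ) : ℝ) * h) (n * h), u ≤ x := fun u m => hxh ▸ m.2
  have em := norm_euler_maclaurin_error_le h0 hn
    (g₀ := fun u => r₀ u * p 0 u)
    (g₁ := fun u => r₁ u * p 0 u + r₀ u * p 1 u)
    (g₂ := fun u => r₂ u * p 0 u + 2 * (r₁ u * p 1 u) + r₀ u * p 2 u)
    (g₃ := fun u => r₃ u * p 0 u + 3 * (r₂ u * p 1 u) + 3 * (r₁ u * p 2 u) + r₀ u * p 3 u)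
    (g₄ := fun u => r₄ u * p 0 u + 4 * (r₃ u * p 1 u) + 6 * (r₂ u * p 2 u)
      + 4 * (r₁ u * p 3 u) + r₀ u * p 4 u)
    (φ := fun u => 16 * (M * 6 ^ 4) * u ^ (-α))
    (fun u m => (d₀ u).fun_mul (dp 0 u (pos u m)))
    (fun u m => by
      convert ((d₁ u).fun_mul (dp 0 u (pos u m))).fun_add ((d₀ u).fun_mul (dp 1 u (pos u m)))
        using 1
      ring)
    (fun u m => by
      convert (((d₂ u).fun_mul (dp 0 u (pos u m))).fun_add
        (((d₁ u).fun_mul (dp 1 u (pos u m))).const_mul 2)).fun_add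
        ((d₀ u).fun_mul (dp 2 u (pos u m))) using 1
      ring)
    (fun u m => by
      convert ((((d₃ u).fun_mul (dp 0 u (pos u m))).fun_add
        (((d₂ u).fun_mul (dp 1 u (pos u m))).const_mul 3)).fun_add
        (((d₁ u).fun_mul (dp 2 u (pos u m))).const_mul 3)).fun_add
        ((d₀ u).fun_mul (dp 3 u (pos u m))) using 1
      ring)
    (fun u m => by
      have cp := fun i => (dp i u (pos u m)).continuousAt
      exact (((((d₄ u).continuousAt.mul (cp 0)).add
        (continuousAt_const.mul ((d₃ u).continuousAt.mul (cp 1)))).add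
        (continuousAt_const.mul ((d₂ u).continuousAt.mul (cp 2)))).add
        (continuousAt_const.mul ((d₁ u).continuousAt.mul (cp 3)))).add
        ((d₀ u).continuousAt.mul (cp 4)) |>.continuousWithinAt)
    (fun u m => (continuousAt_const.mul
      (Real.continuousAt_rpow_const _ _ (Or.inl (pos u m).ne'))).continuousWithinAt)
    (fun u m => by
      have t0 := abs_le.1 (brp 0 1 (-α) r₄ (by norm_num) b₄ (by rw [hq]; push_cast; ring) u
        (pos u m) (lex u m))
      have t1 := abs_le.1 (brp 1 2 (-α) r₃ (by norm_num) b₃ (by rw [hq]; push_cast; ring) u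
        (pos u m) (lex u m))
      have t2 := abs_le.1 (brp 2 3 (-α) r₂ (by norm_num) b₂ (by rw [hq]; push_cast; ring) u
        (pos u m) (lex u m))
      have t3 := abs_le.1 (brp 3 4 (-α) r₁ (by norm_num) b₁ (by rw [hq]; push_cast; ring) u
        (pos u m) (lex u m))
      have t4 := abs_le.1 (brp 4 5 (-α) r₀ (by norm_num) b₀ (by rw [hq]; push_cast; ring) u
        (pos u m) (lex u m))
      rw [Real.norm_eq_abs, abs_le]
      constructor
      · linarith [t0.1, t1.1, t2.1, t3.1, t4.1]
      · linarith [t0.2, t1.2, t2.2, t3.2, t4.2])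
  simp only [Nat.cast_one, one_mul, ← hxh, smul_eq_mul] at em pos
  have intφ : (∫ u in h..x, 16 * (M * 6 ^ 4) * u ^ (-α))
      ≤ 16 * (M * 6 ^ 4) * (x ^ (1 - α) / (1 - α)) := by
    rw [intervalIntegral.integral_const_mul, integral_rpow (Or.inl (by linarith)),
      show -α + 1 = 1 - α by ring]
    have : 0 < 1 - α := by linarith
    gcongr
    linarith [Real.rpow_nonneg h0.le (1 - α)]
  have em' := em.trans (mul_le_mul_of_nonneg_left intφ (by positivity))
  have parts : (∫ u in h..x, (r₁ u * u ^ (-α) - α * (r₀ u * p 0 u)))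
      = r₀ x * x ^ (-α) - r₀ h * h ^ (-α) := by
    refine intervalIntegral.integral_eq_sub_of_hasDerivAt
      (f := fun u => r₀ u * u ^ (-α)) (fun u m => ?_) (ContinuousOn.intervalIntegrable ?_)
    · rw [Set.uIcc_of_le hhx] at m
      refine ((d₀ u).fun_mul
        (Real.hasDerivAt_rpow_const (p := -α) (Or.inl (pos u m).ne'))).congr_deriv ?_
      simp only [hp, hq]
      rw [show -(1 + α) - ((0 : ℕ) : ℝ) = -α - 1 by push_cast; ring]
      simp only [Finset.range_zero, Finset.prod_empty]
      ring
    · intro u m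
      rw [Set.uIcc_of_le hhx] at m
      exact (((d₁ u).continuousAt.mul (Real.continuousAt_rpow_const _ _ (Or.inl (pos u m).ne'))).sub
        (continuousAt_const.mul ((d₀ u).continuousAt.mul
          (dp 0 u (pos u m)).continuousAt))).continuousWithinAt
  rw [intervalIntegral.integral_sub (intervalIntegrable_mul_rpow_neg hα1 (cont d₁) _ _)
    (ContinuousOn.intervalIntegrable fun u m => by
      rw [Set.uIcc_of_le hhx] at m
      exact (continuousAt_const.mul ((d₀ u).continuousAt.mul
          (dp 0 u (pos u m)).continuousAt)).continuousWithinAt),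
    intervalIntegral.integral_const_mul] at parts
  have split := intervalIntegral.integral_add_adjacent_intervals
    (intervalIntegrable_mul_rpow_neg hα1 (cont d₁) 0 h)
    (intervalIntegrable_mul_rpow_neg hα1 (cont d₁) h x)
  have sm : h ^ (-α) * (∑ k ∈ Finset.Ico 1 n, r₀ (k * h) * (k : ℝ) ^ q)
      = h * ∑ k ∈ Finset.Ico 1 n, r₀ (k * h) * p 0 (k * h) := by
    rw [Finset.mul_sum, Finset.mul_sum]
    refine Finset.sum_congr rfl fun k hk => ?_
    simp only [hp, Finset.range_zero, Finset.prod_empty, Nat.cast_zero, sub_zero, one_mul]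
    rw [Real.mul_rpow k.cast_nonneg h0.le, show -α = 1 + q by rw [hq]; ring, Real.rpow_add h0,
      Real.rpow_one]
    ring
  have p0 : p 0 x = x ^ q := by simp [hp]
  have p1 : p 1 x = q * x ^ (-(2 + α)) := by
    simp only [hp, Finset.prod_range_one, Nat.cast_zero, sub_zero, Nat.cast_one]
    congr 2; rw [hq]; ring
  have xq : x * x ^ (-(2 + α)) = x ^ q := by
    nth_rewrite 1 [← Real.rpow_one x]
    rw [← Real.rpow_add hx]; congr 1; rw [hq]; ring
  have key : expansionError α x n r₀ r₁
      = ((∫ u in h..x, r₀ u * p 0 u) - h * (∑ k ∈ Finset.Ico 1 n, r₀ (k * h) * p 0 (k * h))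
        - h / 2 * (r₀ x * p 0 x - r₀ h * p 0 h)
        + h ^ 2 / 12 * (r₁ x * p 0 x + r₀ x * p 1 x - (r₁ h * p 0 h + r₀ h * p 1 h)))
        + (1 / α * (∫ u in (0 : ℝ)..h, r₁ u * u ^ (-α)) - 1 / α * (r₀ h * h ^ (-α))
          - h / 2 * (r₀ h * p 0 h) + h ^ 2 / 12 * (r₁ h * p 0 h + r₀ h * p 1 h)) := by
    have split' : (∫ u in (0 : ℝ)..x, r₁ u * u ^ (-α)) = (∫ u in (0 : ℝ)..h, r₁ u * u ^ (-α))
        + (r₀ x * x ^ (-α) - r₀ h * h ^ (-α) + α * ∫ u in h..x, r₀ u * p 0 u) := by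
      rw [← split, ← parts]; ring
    have hα : 1 / α * α = 1 := by field_simp
    rw [expansionError, ← hq, ← hh, sm, split', p1, p0, ← xq]
    linear_combination (∫ u in h..x, r₀ u * p 0 u) * hα +
      (-h ^ 2 / 12 * r₀ x * x ^ (-(2 + α))) * hq
  have hpow : h ^ (5 - α) = h ^ 4 * h ^ (1 - α) := by
    rw [← Real.rpow_natCast h 4, ← Real.rpow_add h0]; congr 1; push_cast; ring
  have hpow4 : h ^ (4 - α) * h = h ^ (5 - α) := by
    rw [← Real.rpow_add_one h0.ne']; congr 1; ring
  have hpow3 : h ^ (3 - α) * h ^ 2 = h ^ (5 - α) := by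
    rw [← Real.rpow_add_natCast h0.ne']; congr 1; push_cast; ring
  have hle : h ^ (5 - α) ≤ h ^ 4 * x ^ (1 - α) := by
    rw [hpow]; gcongr
  have B1 : |∫ u in (0 : ℝ)..h, r₁ u * u ^ (-α)| ≤ M * 6 ^ 4 * h ^ (5 - α) := by
    have := intervalIntegral.norm_integral_le_of_norm_le_const (a := 0) (b := h)
      (f := fun u => r₁ u * u ^ (-α)) (C := M * h ^ (4 - α)) fun u hu => by
        rw [Set.uIoc_of_le h0.le] at hu
        rw [Real.norm_eq_abs, abs_mul, abs_of_pos (Real.rpow_pos_of_pos hu.1 _)]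
        calc _ ≤ (M * u ^ 4) * u ^ (-α) := by
              gcongr
              · exact (Real.rpow_pos_of_pos hu.1 _).le
              · exact b₁ u ⟨hu.1.le, hu.2.trans hhx⟩
          _ = M * u ^ (4 - α) := by
              rw [mul_assoc, ← Real.rpow_natCast, ← Real.rpow_add hu.1]; congr 2
          _ ≤ _ := by
              gcongr
              · exact hu.1.le
              · linarith
              · exact hu.2
    rw [Real.norm_eq_abs, sub_zero, abs_of_pos h0, mul_assoc, hpow4] at this
    refine this.trans ?_
    have : 0 ≤ M * h ^ (5 - α) := by positivity
    linarith
  have B2 : |r₀ h * h ^ (-α)| ≤ M * 6 ^ 4 * h ^ (5 - α) := by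
    rw [abs_mul, abs_of_pos (Real.rpow_pos_of_pos h0 (-α))]
    calc _ ≤ (M * h ^ 5) * h ^ (-α) := by gcongr; exact b₀ h ⟨h0.le, hhx⟩
      _ = M * h ^ (5 - α) := by
        rw [mul_assoc, ← Real.rpow_natCast, ← Real.rpow_add h0]; congr 2
      _ ≤ _ := by
        have : 0 ≤ M * h ^ (5 - α) := by positivity
        linarith
  have B3 := brp 0 5 (4 - α) r₀ (by norm_num) b₀ (by rw [hq]; push_cast; ring) h h0 hhx
  have B4 := brp 0 4 (3 - α) r₁ (by norm_num) b₁ (by rw [hq]; push_cast; ring) h h0 hhx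
  have B5 := brp 1 5 (3 - α) r₀ (by norm_num) b₀ (by rw [hq]; push_cast; ring) h h0 hhx
  have B3' : |h / 2 * (r₀ h * p 0 h)| ≤ M * 6 ^ 4 * h ^ (5 - α) / 2 := by
    rw [abs_mul, abs_of_pos (by positivity : 0 < h / 2), ← hpow4]
    calc _ ≤ h / 2 * (M * 6 ^ 4 * h ^ (4 - α)) := by gcongr
      _ = _ := by ring
  have B4' : |h ^ 2 / 12 * (r₁ h * p 0 h + r₀ h * p 1 h)| ≤ M * 6 ^ 4 * h ^ (5 - α) / 6 := by
    rw [abs_mul, abs_of_pos (by positivity : 0 < h ^ 2 / 12), ← hpow3]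
    calc _ ≤ h ^ 2 / 12 * (M * 6 ^ 4 * h ^ (3 - α) + M * 6 ^ 4 * h ^ (3 - α)) := by
          gcongr; exact (abs_add_le _ _).trans (add_le_add B4 B5)
      _ = _ := by ring
  have B1' : |1 / α * ∫ u in (0 : ℝ)..h, r₁ u * u ^ (-α)|
      ≤ 1 / α * (M * 6 ^ 4 * h ^ (5 - α)) := by
    rw [abs_mul, abs_of_pos (by positivity : 0 < 1 / α)]; gcongr
  have B2' : |1 / α * (r₀ h * h ^ (-α))| ≤ 1 / α * (M * 6 ^ 4 * h ^ (5 - α)) := by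
    rw [abs_mul, abs_of_pos (by positivity : 0 < 1 / α)]; gcongr
  rw [key, ← hh]
  refine (abs_add_le _ _).trans ?_
  have tail : |1 / α * (∫ u in (0 : ℝ)..h, r₁ u * u ^ (-α)) - 1 / α * (r₀ h * h ^ (-α))
          - h / 2 * (r₀ h * p 0 h) + h ^ 2 / 12 * (r₁ h * p 0 h + r₀ h * p 1 h)|
      ≤ (M * 6 ^ 4) * h ^ (5 - α) * (2 / α + 1) := by
    have hk : 0 ≤ M * 6 ^ 4 * h ^ (5 - α) := by positivity
    have e : (M * 6 ^ 4) * h ^ (5 - α) * (2 / α + 1) = 1 / α * (M * 6 ^ 4 * h ^ (5 - α))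
      + 1 / α * (M * 6 ^ 4 * h ^ (5 - α)) + M * 6 ^ 4 * h ^ (5 - α) := by ring
    rw [e]
    rw [abs_le] at *
    constructor <;> linarith [B1'.1, B2'.1, B3'.1, B4'.1, B1'.2, B2'.2, B3'.2, B4'.2]
  have tail' : (M * 6 ^ 4) * h ^ (5 - α) * (2 / α + 1)
      ≤ (M * 6 ^ 4) * (h ^ 4 * x ^ (1 - α)) * (2 / α + 1) := by gcongr
  rw [Real.norm_eq_abs] at em'
  linarith

theorem exists_abs_expansionError_smooth_le {α x : ℝ} (hα0 : 0 < α) (hα1 : α < 1) (hx : 0 < x)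
    {f : ℕ → ℝ → ℝ} (hf : ∀ j u, HasDerivAt (f j) (f (j + 1) u) u) :
    ∃ C : ℝ, 0 ≤ C ∧ ∀ n : ℕ, 0 < n →
      |expansionError α x n (f 0) (f 1)
        + (f 0 0 * (zr (1 + α) * (x / n) ^ (-α)) + f 1 0 * (zr α * (x / n) ^ (1 - α))
          + f 2 0 / 2 * (zr (α - 1) * (x / n) ^ (2 - α))
          + f 3 0 / 6 * (zr (α - 2) * (x / n) ^ (3 - α))
          + f 4 0 / 24 * (zr (α - 3) * (x / n) ^ (4 - α)))| ≤ C * (x / n) ^ 4 := by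
  have fc : ∀ j, Continuous (f j) := fun j =>
    continuous_iff_continuousAt.2 fun u => (hf j u).continuousAt
  obtain ⟨Cr, Cr0, hr⟩ := exists_abs_expansionError_remainder_le hα0 hα1 hx
    (r₀ := fun u => f 0 u - (f 0 0 + f 1 0 * u + f 2 0 / 2 * u ^ 2 + f 3 0 / 6 * u ^ 3
      + f 4 0 / 24 * u ^ 4))
    (r₁ := fun u => f 1 u - (f 1 0 + f 2 0 * u + f 3 0 / 2 * u ^ 2 + f 4 0 / 6 * u ^ 3))
    (r₂ := fun u => f 2 u - (f 2 0 + f 3 0 * u + f 4 0 / 2 * u ^ 2))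
    (r₃ := fun u => f 3 u - (f 3 0 + f 4 0 * u))
    (r₄ := fun u => f 4 u - f 4 0) (r₅ := f 5)
    (fun u => ((hf 0 u).fun_sub ((((((hasDerivAt_id' u).const_mul (f 1 0)).const_add
      (f 0 0)).fun_add ((hasDerivAt_pow 2 u).const_mul (f 2 0 / 2))).fun_add
      ((hasDerivAt_pow 3 u).const_mul (f 3 0 / 6))).fun_add
      ((hasDerivAt_pow 4 u).const_mul (f 4 0 / 24)))).congr_deriv (by push_cast; ring))
    (fun u => ((hf 1 u).fun_sub (((((hasDerivAt_id' u).const_mul (f 2 0)).const_add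
      (f 1 0)).fun_add ((hasDerivAt_pow 2 u).const_mul (f 3 0 / 2))).fun_add
      ((hasDerivAt_pow 3 u).const_mul (f 4 0 / 6)))).congr_deriv (by push_cast; ring))
    (fun u => ((hf 2 u).fun_sub ((((hasDerivAt_id' u).const_mul (f 3 0)).const_add
      (f 2 0)).fun_add ((hasDerivAt_pow 2 u).const_mul (f 4 0 / 2)))).congr_deriv
      (by push_cast; ring))
    (fun u => ((hf 3 u).fun_sub (((hasDerivAt_id' u).const_mul (f 4 0)).const_add
      (f 3 0))).congr_deriv (by ring))
    (fun u => (hf 4 u).sub_const _) (fc 5) (by simp) (by simp) (by simp) (by simp) (by simp)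
  obtain ⟨C0, C00, h0⟩ := exists_abs_expansionError_pow_le hα0 hα1 hx (j := 0) (by norm_num)
  obtain ⟨C1, C10, h1⟩ := exists_abs_expansionError_pow_le hα0 hα1 hx (j := 1) (by norm_num)
  obtain ⟨C2, C20, h2⟩ := exists_abs_expansionError_pow_le hα0 hα1 hx (j := 2) (by norm_num)
  obtain ⟨C3, C30, h3⟩ := exists_abs_expansionError_pow_le hα0 hα1 hx (j := 3) (by norm_num)
  obtain ⟨C4, C40, h4⟩ := exists_abs_expansionError_pow_le hα0 hα1 hx (j := 4) (by norm_num)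
  refine ⟨Cr + |f 0 0| * C0 + |f 1 0| * C1 + |f 2 0 / 2| * C2 + |f 3 0 / 6| * C3
    + |f 4 0 / 24| * C4, by positivity, fun n hn => ?_⟩
  have lin := fun (a : ℝ) (j : ℕ) (F F' : ℝ → ℝ) (hF : Continuous F') =>
    expansionError_add_const_mul hα1 x n a (F := F) (G := fun u => u ^ j)
      (G' := fun u => (j : ℝ) * u ^ (j - 1)) hF (by fun_prop)
  have f1c := fc 1
  let R₀ : ℝ → ℝ := fun u => f 0 u - (f 0 0 + f 1 0 * u + f 2 0 / 2 * u ^ 2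
    + f 3 0 / 6 * u ^ 3 + f 4 0 / 24 * u ^ 4)
  let R₁ : ℝ → ℝ := fun u => f 1 u - (f 1 0 + f 2 0 * u + f 3 0 / 2 * u ^ 2 + f 4 0 / 6 * u ^ 3)
  have R₁c : Continuous R₁ := by fun_prop
  let E : ℕ → ℝ := fun j => expansionError α x n (fun u => u ^ j) (fun u => (j : ℝ) * u ^ (j - 1))
  have e : expansionError α x n (f 0) (f 1) = expansionError α x n R₀ R₁ + f 0 0 * E 0
      + f 1 0 * E 1 + f 2 0 / 2 * E 2 + f 3 0 / 6 * E 3 + f 4 0 / 24 * E 4 := by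
    rw [← lin (f 0 0) 0 _ _ R₁c, ← lin (f 1 0) 1 _ _ (by fun_prop),
      ← lin (f 2 0 / 2) 2 _ _ (by fun_prop), ← lin (f 3 0 / 6) 3 _ _ (by fun_prop),
      ← lin (f 4 0 / 24) 4 _ _ (by fun_prop)]
    congr 1 <;> (ext u; simp only [R₀, R₁]; push_cast; ring)
  have scale : ∀ a A C : ℝ, |A| ≤ C * (x / n) ^ 4 → |a * A| ≤ |a| * C * (x / n) ^ 4 :=
    fun a A C h => by rw [abs_mul, mul_assoc]; gcongr
  have t : |expansionError α x n R₀ R₁| ≤ Cr * (x / n) ^ 4 := hr n hn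
  have t0 := scale (f 0 0) (E 0 + _) _ (h0 n hn)
  have t1 := scale (f 1 0) (E 1 + _) _ (h1 n hn)
  have t2 := scale (f 2 0 / 2) (E 2 + _) _ (h2 n hn)
  have t3 := scale (f 3 0 / 6) (E 3 + _) _ (h3 n hn)
  have t4 := scale (f 4 0 / 24) (E 4 + _) _ (h4 n hn)
  rw [show (1 : ℝ) + α - (0 : ℕ) = 1 + α by push_cast; ring,
    show ((0 : ℕ) : ℝ) - α = -α by push_cast; ring] at t0
  rw [show (1 : ℝ) + α - (1 : ℕ) = α by push_cast; ring, Nat.cast_one] at t1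
  rw [show (1 : ℝ) + α - (2 : ℕ) = α - 1 by push_cast; ring, Nat.cast_ofNat] at t2
  rw [show (1 : ℝ) + α - (3 : ℕ) = α - 2 by push_cast; ring, Nat.cast_ofNat] at t3
  rw [show (1 : ℝ) + α - (4 : ℕ) = α - 3 by push_cast; ring, Nat.cast_ofNat] at t4
  rw [e]
  rw [abs_le] at t t0 t1 t2 t3 t4 ⊢
  constructor <;>
    linarith [t.1, t0.1, t1.1, t2.1, t3.1, t4.1, t.2, t0.2, t1.2, t2.2, t3.2, t4.2]

theorem Gamma_neg_mul_caputo {α x : ℝ} (hα0 : 0 < α) (hα1 : α < 1) (hx : 0 < x) (y : ℝ → ℝ) :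
    Real.Gamma (-α) * caputo α y x
      = 1 / α * ∫ u in (0 : ℝ)..x, -deriv y (x - u) * u ^ (-α) := by
  have hΓ : Real.Gamma (1 - α) = -α * Real.Gamma (-α) := by
    rw [← Real.Gamma_add_one (neg_ne_zero.2 hα0.ne'), neg_add_eq_sub]
  have hne : Real.Gamma (1 - α) ≠ 0 := (Real.Gamma_pos_of_pos (by linarith)).ne'
  have hne' : Real.Gamma (-α) ≠ 0 := fun h => hne (by rw [hΓ, h, mul_zero])
  have i : (∫ t in (0 : ℝ)..x, deriv y t / (x - t) ^ α)
      = -∫ u in (0 : ℝ)..x, -deriv y (x - u) * u ^ (-α) := by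
    have := intervalIntegral.integral_comp_sub_left (a := 0) (b := x)
      (fun u => deriv y (x - u) / u ^ α) x
    simp only [sub_sub_cancel, sub_self, sub_zero] at this
    rw [this, ← intervalIntegral.integral_neg]
    refine intervalIntegral.integral_congr fun u hu => ?_
    rw [Set.uIcc_of_le hx.le] at hu
    rw [Real.rpow_neg hu.1]
    ring
  rw [caputo, i, hΓ]
  field_simp

end FractionalRiemannSum

theorem fourth_order_expansion
    (α x : ℝ) (hα0 : 0 < α) (hα1 : α < 1) (hx : 0 < x)
    (y : ℝ → ℝ) (hy : ContDiff ℝ (⊤ : ℕ∞) y) :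
    ∃ C > 0, ∀ n : ℕ, 2 ≤ n →
      |Real.Gamma (-α) * caputo α y x
        - ((x / n) ^ (-α) *
              (∑ k ∈ Finset.Icc 1 (n - 1), y (x - (k:ℝ) * (x / n)) / (k:ℝ) ^ (1 + α))
            - zr (1 + α) * y x * (x / n) ^ (-α)
            + y 0 / (α * x ^ α)
            + y 0 * (x / n) / (2 * x ^ (1 + α))
            + zr α * deriv y x * (x / n) ^ (1 - α)
            - (zr (α - 1) / 2) * iteratedDeriv 2 y x * (x / n) ^ (2 - α)
            + (zr (α - 2) / 6) * iteratedDeriv 3 y x * (x / n) ^ (3 - α)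
            - (zr (α - 3) / 24) * iteratedDeriv 4 y x * (x / n) ^ (4 - α)
            + ((x * deriv y 0 + (1 + α) * y 0) / (12 * x ^ (2 + α))) * (x / n) ^ 2)|
      ≤ C * (x / n) ^ 4 := by
  have hd : ∀ (j : ℕ) (u : ℝ), HasDerivAt (fun u => (-1) ^ j * iteratedDeriv j y (x - u))
      ((-1) ^ (j + 1) * iteratedDeriv (j + 1) y (x - u)) u := fun j u => by
    have d := ((hy.differentiable_iteratedDeriv j (by exact_mod_cast ENat.natCast_lt_top j)
      (x - u)).hasDerivAt.comp_const_sub x u).const_mul ((-1) ^ j)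
    rw [iteratedDeriv_succ]
    exact d.congr_deriv (by ring)
  obtain ⟨C, C0, hC⟩ := exists_abs_expansionError_smooth_le hα0 hα1 hx hd
  refine ⟨C + 1, by linarith, fun n hn => ?_⟩
  have hn0 : 0 < n := by omega
  refine le_trans (le_of_eq ?_) ((hC n hn0).trans
    (mul_le_mul_of_nonneg_right (by linarith) (by positivity)))
  have hI : Finset.Icc 1 (n - 1) = Finset.Ico 1 n := by
    ext k; simp only [Finset.mem_Icc, Finset.mem_Ico]; omega
  have hsum : (∑ k ∈ Finset.Icc 1 (n - 1), y (x - (k : ℝ) * (x / n)) / (k : ℝ) ^ (1 + α))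
      = ∑ k ∈ Finset.Ico 1 n, y (x - (k : ℝ) * (x / n)) * (k : ℝ) ^ (-(1 + α)) := by
    rw [hI]
    refine Finset.sum_congr rfl fun k _ => ?_
    rw [Real.rpow_neg k.cast_nonneg, div_eq_mul_inv]
  rw [Gamma_neg_mul_caputo hα0 hα1 hx, hsum, expansionError]
  simp only [pow_zero, one_mul, iteratedDeriv_zero, pow_one, iteratedDeriv_one, sub_self,
    sub_zero, Real.rpow_neg hx.le, neg_mul]
  congr 1
  ring
end
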